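/- arXiv:2012.05666 — 6 statements merged into one kernel-verified Lean document; each statement's English description precedes it below -/
import Mathlib

section
/- Let α > 0. The function x ↦ L_α(−x) is completely monotone on (0,∞) if and only if α ≤ 1. -/
/-- The Le Roy function `L_α(x)`. -/
noncomputable def leRoy (α : ℝ) (x : ℝ) : ℝ :=
  ∑' n : ℕ, x ^ n / (n.factorial : ℝ) ^ α

/-- A function `f` is completely monotone on `(0,∞)`. -/
def CompletelyMonotoneOn (f : ℝ → ℝ) : Prop :=
  (∀ n : ℕ, DifferentiableOn ℝ (iteratedDerivWithin n f (Set.Ioi 0)) (Set.Ioi 0)) ∧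
  ∀ n : ℕ, ∀ x ∈ Set.Ioi (0 : ℝ), 0 ≤ (-1) ^ n * iteratedDerivWithin n f (Set.Ioi 0) x

open Filter Topology MeasureTheory

/-- The `j`-th derivative (up to sign) of `x ↦ L_{1-s}(-x)`. -/
noncomputable def leRoyG (s : ℝ) (j : ℕ) (x : ℝ) : ℝ :=
  ∑' n : ℕ, ((n + j).factorial : ℝ) ^ s * ((-x) ^ n / (n.factorial : ℝ))

lemma leRoyG_summable {s : ℝ} (hs : s < 1) (j : ℕ) (x : ℝ) :
    Summable (fun n : ℕ => ((n + j).factorial : ℝ) ^ s * (x ^ n / (n.factorial : ℝ))) := by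
  refine summable_of_ratio_norm_eventually_le (r := 1/2) (by norm_num) ?_
  have h1 : Tendsto (fun n : ℕ => ((n + j + 1 : ℕ) : ℝ) ^ (-(1 - s)) * ((j + 1) * |x|)) atTop
      (𝓝 (0 * ((j + 1) * |x|))) := by
    refine Tendsto.mul_const _ ?_
    refine (tendsto_rpow_neg_atTop (by linarith : 0 < 1 - s)).comp ?_
    refine tendsto_natCast_atTop_atTop.comp ?_
    exact tendsto_atTop_mono (fun n => by simp only [id]; omega) tendsto_id
  rw [zero_mul] at h1
  filter_upwards [h1.eventually (eventually_le_nhds (by norm_num : (0:ℝ) < 1/2))] with n hn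
  have hp : (0:ℝ) < ((n + j + 1 : ℕ) : ℝ) := by positivity
  have e1 : (((n + 1 + j).factorial : ℕ) : ℝ) ^ s
      = ((n + j + 1 : ℕ) : ℝ) ^ s * ((n + j).factorial : ℝ) ^ s := by
    rw [show n + 1 + j = n + j + 1 by ring, Nat.factorial_succ, Nat.cast_mul,
      Real.mul_rpow (by positivity) (by positivity)]
  have e2 : ((n + j + 1 : ℕ) : ℝ) ^ s
      = ((n + j + 1 : ℕ) : ℝ) ^ (-(1 - s)) * ((n + j + 1 : ℕ) : ℝ) := by
    conv_rhs => rw [← Real.rpow_add_one hp.ne']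
    congr 1; ring
  have e3 : (((n + 1).factorial : ℕ) : ℝ) = (n + 1) * (n.factorial : ℝ) := by
    rw [Nat.factorial_succ]; push_cast; ring
  have hA : (0:ℝ) ≤ ((n + j).factorial : ℝ) ^ s := by positivity
  have hB : (0:ℝ) ≤ ((n + j + 1 : ℕ) : ℝ) ^ (-(1 - s)) := by positivity
  rw [e1, e2, e3]
  simp only [norm_mul, norm_div, norm_pow, Real.norm_eq_abs]
  rw [abs_of_nonneg hA, abs_of_nonneg hB, abs_of_pos hp, Nat.abs_cast,
    abs_of_pos (by positivity : (0:ℝ) < n + 1)]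
  set A := ((n + j).factorial : ℝ) ^ s
  set B := ((n + j + 1 : ℕ) : ℝ) ^ (-(1 - s))
  have h4 : ((n + j + 1 : ℕ) : ℝ) / (n + 1) ≤ j + 1 := by
    rw [div_le_iff₀ (by positivity)]
    push_cast
    nlinarith [(Nat.cast_nonneg n : (0:ℝ) ≤ n), (Nat.cast_nonneg j : (0:ℝ) ≤ j),
      mul_nonneg (Nat.cast_nonneg n : (0:ℝ) ≤ n) (Nat.cast_nonneg j : (0:ℝ) ≤ j)]
  calc B * ((n + j + 1 : ℕ) : ℝ) * A * (|x| ^ (n + 1) / ((n + 1) * (n.factorial : ℝ)))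
      = B * ((((n + j + 1 : ℕ) : ℝ) / (n + 1)) * |x|) * (A * (|x| ^ n / (n.factorial : ℝ))) := by
        field_simp
        ring
    _ ≤ B * ((j + 1) * |x|) * (A * (|x| ^ n / (n.factorial : ℝ))) := by gcongr
    _ ≤ 1 / 2 * (A * (|x| ^ n / (n.factorial : ℝ))) := by gcongr

lemma leRoyG_shift (s : ℝ) (j n : ℕ) (x : ℝ) :
    ((n + 1 + j).factorial : ℝ) ^ s * ((((n + 1 : ℕ) : ℝ) * x ^ n) / ((n + 1).factorial : ℝ))
     = ((n + (j + 1)).factorial : ℝ) ^ s * (x ^ n / (n.factorial : ℝ)) := by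
  rw [show n + 1 + j = n + (j + 1) by ring, Nat.factorial_succ n]
  push_cast
  field_simp

lemma leRoyG_hasDerivAt {s : ℝ} (hs : s < 1) (j : ℕ) (x : ℝ) :
    HasDerivAt (leRoyG s j) (-leRoyG s (j + 1) x) x := by
  set R := |x| + 1 with hR
  have hsum : ∀ y : ℝ, Summable (fun n : ℕ =>
      ((n + j).factorial : ℝ) ^ s * (((n : ℝ) * y ^ (n - 1)) / (n.factorial : ℝ))) := by
    intro y
    rw [← summable_nat_add_iff 1]
    refine (leRoyG_summable hs (j + 1) y).congr fun n => ?_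
    rw [← leRoyG_shift s j n y]; simp
  have key := hasDerivAt_tsum_of_isPreconnected (𝕜 := ℝ) (F := ℝ)
    (g := fun (n : ℕ) (y : ℝ) => ((n + j).factorial : ℝ) ^ s * ((-y) ^ n / (n.factorial : ℝ)))
    (g' := fun (n : ℕ) (y : ℝ) =>
      -(((n + j).factorial : ℝ) ^ s * (((n : ℝ) * (-y) ^ (n - 1)) / (n.factorial : ℝ))))
    (t := Metric.ball 0 R) (y₀ := x) (y := x) (hsum R) Metric.isOpen_ball
    (convex_ball 0 R).isPreconnected ?_ ?_ ?_ (leRoyG_summable hs j (-x)) ?_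
  · convert! key using 1
    rw [tsum_neg, (hsum (-x)).tsum_eq_zero_add]
    simp only [leRoyG, Nat.cast_zero, zero_mul, zero_div, mul_zero, zero_add,
      Nat.add_sub_cancel, leRoyG_shift]
  · intro n y _
    have h := ((((hasDerivAt_id y).neg).pow n).div_const (n.factorial : ℝ)).const_mul
      (((n + j).factorial : ℝ) ^ s)
    convert! h using 1
    simp
    ring
  · intro n y hy
    have hy' : |y| ≤ R := by
      have := Metric.mem_ball.1 hy
      rw [dist_zero_right, Real.norm_eq_abs] at this
      exact this.le
    rw [norm_neg, norm_mul, norm_div, norm_mul, norm_pow, norm_neg]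
    simp only [Real.norm_eq_abs, Nat.abs_cast]
    rw [abs_of_nonneg (by positivity : (0:ℝ) ≤ ((n + j).factorial : ℝ) ^ s)]
    gcongr
  · simp [hR]
  · simp [hR]

lemma leRoy_eq_leRoyG (α x : ℝ) : leRoy α (-x) = leRoyG (1 - α) 0 x := by
  unfold leRoy leRoyG
  refine tsum_congr fun n => ?_
  have h : (0:ℝ) < (n.factorial : ℝ) := by positivity
  rw [Nat.add_zero, Real.rpow_sub h, Real.rpow_one]
  field_simp

lemma leRoy_iteratedDerivWithin {α : ℝ} (hα : 0 < α) (n : ℕ) :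
    Set.EqOn (iteratedDerivWithin n (fun x => leRoy α (-x)) (Set.Ioi 0))
      (fun x => (-1) ^ n * leRoyG (1 - α) n x) (Set.Ioi 0) := by
  induction n with
  | zero => intro x _; simp [leRoy_eq_leRoyG]
  | succ n ih =>
    intro x hx
    rw [iteratedDerivWithin_succ, derivWithin_congr ih (ih hx)]
    have h := (leRoyG_hasDerivAt (by linarith : 1 - α < 1) n x).const_mul ((-1 : ℝ) ^ n)
    rw [h.hasDerivWithinAt.derivWithin (isOpen_Ioi.uniqueDiffWithinAt hx)]
    ring

lemma leRoy_cm_iff {α : ℝ} (hα : 0 < α) :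
    CompletelyMonotoneOn (fun x => leRoy α (-x)) ↔
      ∀ n : ℕ, ∀ x : ℝ, 0 < x → 0 ≤ leRoyG (1 - α) n x := by
  have e : ∀ n : ℕ, ∀ x : ℝ, 0 < x → (-1) ^ n *
      iteratedDerivWithin n (fun x => leRoy α (-x)) (Set.Ioi 0) x = leRoyG (1 - α) n x := by
    intro n x hx
    rw [leRoy_iteratedDerivWithin hα n hx]
    simp only
    rw [← mul_assoc, ← mul_pow]; simp
  constructor
  · rintro ⟨-, h⟩ n x hx
    rw [← e n x hx]; exact h n x hx
  · intro h
    refine ⟨fun n => ?_, fun n x hx => ?_⟩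
    · refine DifferentiableOn.congr (f := fun x => (-1) ^ n * leRoyG (1 - α) n x) ?_
        (leRoy_iteratedDerivWithin hα n)
      intro x _
      exact ((leRoyG_hasDerivAt (by linarith : 1 - α < 1) n x).const_mul
        ((-1 : ℝ) ^ n)).differentiableAt.differentiableWithinAt
    · rw [e n x hx]; exact h n x hx

/-! ### The case `α > 1` -/

lemma leRoyG_taylor {s : ℝ} (hs : s ≤ 0) (i : ℕ) (b : ℝ) :
    HasSum (fun j : ℕ => b ^ j / (j.factorial : ℝ) * leRoyG s (j + i) b)
      ((i.factorial : ℝ) ^ s) := by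
  set f : ℕ × ℕ → ℝ := fun p => b ^ p.1 / (p.1.factorial : ℝ) *
    (((p.2 + (p.1 + i)).factorial : ℝ) ^ s * ((-b) ^ p.2 / (p.2.factorial : ℝ))) with hf
  have hle : ∀ n : ℕ, (n.factorial : ℝ) ^ s ≤ 1 := fun n =>
    Real.rpow_le_one_of_one_le_of_nonpos (by exact_mod_cast n.factorial_pos) hs
  have hsf : Summable f := by
    have h1 : Summable (fun n : ℕ => |b| ^ n / (n.factorial : ℝ)) :=
      Real.summable_pow_div_factorial |b|
    have h2 := h1.mul_of_nonneg h1 (fun n => by positivity) (fun n => by positivity)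
    refine Summable.of_norm_bounded h2 fun p => ?_
    simp only [hf, norm_mul, norm_div, norm_pow, Real.norm_eq_abs, Nat.abs_cast, abs_neg]
    rw [abs_of_nonneg (by positivity : (0:ℝ) ≤ ((p.2 + (p.1 + i)).factorial : ℝ) ^ s)]
    gcongr
    exact mul_le_of_le_one_left (by positivity) (hle _)
  have hval : HasSum f ((i.factorial : ℝ) ^ s) := by
    have h3 := (Finset.HasAntidiagonal.sigmaAntidiagonalEquivProd (A := ℕ)).hasSum_iff.2 hsf.hasSum
    have h4 := h3.sigma (g := fun N : ℕ => ((N + i).factorial : ℝ) ^ s / (N.factorial : ℝ) *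
        (b + -b) ^ N) ?_
    · have h5 := hasSum_single (f := fun N : ℕ => ((N + i).factorial : ℝ) ^ s /
        (N.factorial : ℝ) * (b + -b) ^ N) 0 (fun N hN => by simp [hN])
      have h6 := h4.unique h5
      simp at h6
      rw [← h6]; exact hsf.hasSum
    · intro N
      have h7 : ((N + i).factorial : ℝ) ^ s / (N.factorial : ℝ) * (b + -b) ^ N =
          ∑ p ∈ Finset.HasAntidiagonal.antidiagonal N, f p := by
        rw [(Commute.all b (-b)).add_pow', Finset.mul_sum]
        refine Finset.sum_congr rfl fun p hp => ?_
        have hp' := Finset.HasAntidiagonal.mem_antidiagonal.1 hp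
        subst hp'
        simp only [hf]
        rw [show p.2 + (p.1 + i) = p.1 + p.2 + i by ring, nsmul_eq_mul,
          Nat.cast_add_choose]
        field_simp
      rw [h7, ← Finset.sum_coe_sort]
      exact hasSum_fintype _
  refine hval.prod_fiberwise fun j => ?_
  exact (leRoyG_summable (by linarith) (j + i) (-b)).hasSum.mul_left _

lemma leRoyG_not_nonneg {s : ℝ} (hs : s < 0)
    (h : ∀ n : ℕ, ∀ x : ℝ, 0 < x → 0 ≤ leRoyG s n x) : False := by
  have key : ∀ b : ℝ, 0 < b → 0 ≤ b ^ 2 * (2:ℝ) ^ s + b - b ^ 2 := by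
    intro b hb
    have t0 := leRoyG_taylor hs.le 0 b
    have t1 := leRoyG_taylor hs.le 1 b
    have t2 := leRoyG_taylor hs.le 2 b
    have u1 : HasSum (fun j : ℕ => (j : ℝ) * (b ^ j / (j.factorial : ℝ) * leRoyG s j b)) b := by
      rw [← hasSum_nat_add_iff' 1]
      convert! t1.mul_left b using 1
      · ext j
        rw [Nat.factorial_succ]
        push_cast
        field_simp
        ring
      · simp
    have u2 : HasSum (fun j : ℕ => (j : ℝ) * (j - 1) * (b ^ j / (j.factorial : ℝ) *
        leRoyG s j b)) (b ^ 2 * 2 ^ s) := by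
      rw [← hasSum_nat_add_iff' 2]
      convert! t2.mul_left (b ^ 2) using 1
      · ext j
        rw [Nat.factorial_succ, Nat.factorial_succ]
        push_cast
        field_simp
        ring
      · simp [Finset.sum_range_succ]
    have tot := (u2.add (u1.mul_left (1 - 2 * b))).add (t0.mul_left (b ^ 2))
    have : (0:ℝ) ≤ b ^ 2 * 2 ^ s + (1 - 2 * b) * b + b ^ 2 * ((Nat.factorial 0 : ℕ) : ℝ) ^ s := by
      refine tot.nonneg fun j => ?_
      have hc : 0 ≤ b ^ j / (j.factorial : ℝ) * leRoyG s j b :=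
        mul_nonneg (by positivity) (h j b hb)
      have : (0:ℝ) ≤ (j - b) ^ 2 * (b ^ j / (j.factorial : ℝ) * leRoyG s j b) :=
        mul_nonneg (sq_nonneg _) hc
      simp only [Nat.add_zero]
      linarith
    simp at this
    linarith
  have hlt : (2:ℝ) ^ s < 1 := Real.rpow_lt_one_of_one_lt_of_neg (by norm_num) hs
  have hd : 0 < 1 - (2:ℝ) ^ s := by linarith
  have := key (2 / (1 - (2:ℝ) ^ s)) (by positivity)
  have e : (2 / (1 - (2:ℝ) ^ s)) ^ 2 * (2:ℝ) ^ s + 2 / (1 - (2:ℝ) ^ s)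
     - (2 / (1 - (2:ℝ) ^ s)) ^ 2 = - (2 / (1 - (2:ℝ) ^ s)) := by
    field_simp
    ring
  rw [e] at this
  have : 0 < 2 / (1 - (2:ℝ) ^ s) := by positivity
  linarith

/-! ### The case `α ≤ 1` -/

/-- Finite products approximating powers of factorials. -/
noncomputable def leRoyC (s : ℝ) (m n : ℕ) : ℝ :=
  ∏ k ∈ Finset.range m, (((k : ℝ) + 1) / (n + k + 1)) ^ s

lemma leRoyC_nonneg (s : ℝ) (m n : ℕ) : 0 ≤ leRoyC s m n :=
  Finset.prod_nonneg fun k _ => by positivity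

lemma leRoyC_le_one {s : ℝ} (hs : 0 ≤ s) (m n : ℕ) : leRoyC s m n ≤ 1 := by
  refine Finset.prod_le_one (fun k _ => by positivity) fun k _ => ?_
  refine Real.rpow_le_one (by positivity) ?_ hs
  rw [div_le_one (by positivity)]
  have : (0:ℝ) ≤ n := by positivity
  linarith

lemma leRoyC_summable {s : ℝ} (hs : 0 ≤ s) (m j : ℕ) (x : ℝ) :
    Summable (fun n : ℕ => leRoyC s m (n + j) * (x ^ n / (n.factorial : ℝ))) := by
  refine Summable.of_norm_bounded (Real.summable_pow_div_factorial |x|) fun n => ?_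
  rw [norm_mul, norm_div, norm_pow]
  simp only [Real.norm_eq_abs, Nat.abs_cast]
  rw [abs_of_nonneg (leRoyC_nonneg s m _)]
  exact mul_le_of_le_one_left (by positivity) (leRoyC_le_one hs _ _)

lemma leRoyC_pos {s : ℝ} (hs : 0 < s) (m j : ℕ) : ∀ x : ℝ,
    0 ≤ ∑' n : ℕ, leRoyC s m (n + j) * ((-x) ^ n / (n.factorial : ℝ)) := by
  induction m with
  | zero =>
    intro x
    simp only [leRoyC, Finset.range_zero, Finset.prod_empty, one_mul]
    have : Real.exp (-x) = ∑' n : ℕ, (-x) ^ n / (n.factorial : ℝ) := by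
      rw [Real.exp_eq_exp_ℝ, NormedSpace.exp_eq_tsum_div]
    rw [← this]; positivity
  | succ m ih =>
    intro x
    set K : ℝ := ((m:ℝ) + 1) ^ s / Real.Gamma s with hK
    have hG : 0 < Real.Gamma s := Real.Gamma_pos_of_pos hs
    have hK0 : 0 ≤ K := by positivity
    have hKint : ∀ n : ℕ, ∫ t in Set.Ioi (0:ℝ), K * (t ^ (s - 1) *
        Real.exp (-(((n + j : ℕ) + m + 1 : ℝ) * t))) =
        (((m : ℝ) + 1) / ((n + j : ℕ) + m + 1)) ^ s := by
      intro n
      rw [integral_const_mul, Real.integral_rpow_mul_exp_neg_mul_Ioi hs (by positivity), hK,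
        Real.div_rpow (by positivity) (by positivity),
        Real.div_rpow (by positivity) (by positivity), Real.one_rpow]
      field_simp
    set F : ℕ → ℝ → ℝ := fun n t => leRoyC s m (n + j) * ((-x) ^ n / (n.factorial : ℝ)) *
      (K * (t ^ (s - 1) * Real.exp (-(((n + j : ℕ) + m + 1 : ℝ) * t)))) with hF
    have hFi : ∀ n, IntegrableOn (F n) (Set.Ioi 0) := by
      intro n
      have := integrableOn_rpow_mul_exp_neg_mul_rpow (p := 1) (s := s - 1)
        (b := ((n + j : ℕ) + m + 1 : ℝ)) (by linarith) one_pos (by positivity)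
      simp only [Real.rpow_one, neg_mul] at this
      exact (this.const_mul K).const_mul _
    have hFI : ∀ n, ∫ t in Set.Ioi (0:ℝ), F n t =
        leRoyC s (m + 1) (n + j) * ((-x) ^ n / (n.factorial : ℝ)) := by
      intro n
      simp only [hF]
      rw [integral_const_mul, hKint n]
      simp only [leRoyC, Finset.prod_range_succ]
      ring
    have hFn : ∀ n, ∫ t in Set.Ioi (0:ℝ), ‖F n t‖ =
        ‖leRoyC s (m + 1) (n + j) * ((-x) ^ n / (n.factorial : ℝ))‖ := by
      intro n
      have : ∀ t ∈ Set.Ioi (0:ℝ), ‖F n t‖ = ‖leRoyC s m (n + j) * ((-x) ^ n / (n.factorial : ℝ))‖ *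
          (K * (t ^ (s - 1) * Real.exp (-(((n + j : ℕ) + m + 1 : ℝ) * t)))) := by
        intro t ht
        have ht' : 0 < t := ht
        simp only [hF]
        rw [norm_mul, Real.norm_of_nonneg (r := K * _) (by positivity)]
      rw [setIntegral_congr_fun measurableSet_Ioi this, integral_const_mul, hKint n]
      simp only [leRoyC, Finset.prod_range_succ]
      rw [norm_mul, norm_mul, norm_mul, Real.norm_of_nonneg
        (r := (((m : ℝ) + 1) / ((n + j : ℕ) + m + 1)) ^ s) (by positivity)]
      ring
    have hS := hasSum_integral_of_summable_integral_norm (μ := volume.restrict (Set.Ioi (0:ℝ)))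
      (F := F) hFi (by
        simp only [hFn]
        exact (leRoyC_summable hs.le (m + 1) j (-x)).norm)
    simp only [hFI] at hS
    rw [hS.tsum_eq]
    refine setIntegral_nonneg measurableSet_Ioi fun t ht => ?_
    have ht' : 0 < t := ht
    have e : ∀ n, F n t = (K * (t ^ (s - 1) * Real.exp (-((j + m + 1 : ℝ) * t)))) *
        (leRoyC s m (n + j) * ((-(x * Real.exp (-t))) ^ n / (n.factorial : ℝ))) := by
      intro n
      have e1 : Real.exp (-(((n + j : ℕ) + m + 1 : ℝ) * t)) =
          Real.exp (-((j + m + 1 : ℝ) * t)) * Real.exp (-t) ^ n := by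
        rw [← Real.exp_nat_mul, ← Real.exp_add]
        congr 1; push_cast; ring
      simp only [hF]
      rw [e1, ← neg_mul x, mul_pow]
      ring
    simp only [e]
    rw [tsum_mul_left]
    exact mul_nonneg (by positivity) (ih _)

/-- The ratio `m^N m! / (N+m)!`. -/
noncomputable def leRoyE (m N : ℕ) : ℝ :=
  (m : ℝ) ^ N * (m.factorial : ℝ) / ((N + m).factorial : ℝ)

lemma leRoyE_succ (m N : ℕ) : leRoyE m (N + 1) = leRoyE m N * ((m : ℝ) / (m + (N + 1))) := by
  unfold leRoyE
  rw [show N + 1 + m = N + m + 1 by ring, Nat.factorial_succ]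
  push_cast
  field_simp
  ring

lemma leRoyE_nonneg (m N : ℕ) : 0 ≤ leRoyE m N := by unfold leRoyE; positivity

lemma leRoyE_le_one (m N : ℕ) : leRoyE m N ≤ 1 := by
  induction N with
  | zero =>
    unfold leRoyE
    simp
    exact div_self_le_one _
  | succ N ih =>
    rw [leRoyE_succ]
    refine mul_le_one₀ ih (by positivity) ?_
    rw [div_le_one (by positivity)]
    have : (0:ℝ) ≤ N := by positivity
    linarith

lemma leRoyE_tendsto (N : ℕ) : Tendsto (fun m => leRoyE m N) atTop (𝓝 1) := by
  induction N with
  | zero =>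
    refine tendsto_const_nhds.congr fun m => ?_
    unfold leRoyE
    have : ((m.factorial : ℕ) : ℝ) ≠ 0 := by positivity
    simp [this]
  | succ N ih =>
    simp only [leRoyE_succ]
    have := ih.mul (tendsto_natCast_div_add_atTop (𝕜 := ℝ) ((N : ℝ) + 1))
    simpa using this

lemma leRoyC_eq (s : ℝ) (m N : ℕ) :
    leRoyC s m N = ((m.factorial : ℝ) * (N.factorial : ℝ) / ((N + m).factorial : ℝ)) ^ s := by
  induction m with
  | zero =>
    have : ((N.factorial : ℕ) : ℝ) ≠ 0 := by positivity
    simp [leRoyC, this]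
  | succ m ih =>
    have : leRoyC s (m + 1) N = leRoyC s m N * (((m : ℝ) + 1) / (N + m + 1)) ^ s := by
      simp only [leRoyC, Finset.prod_range_succ]
    rw [this, ih, ← Real.mul_rpow (by positivity) (by positivity)]
    congr 1
    rw [show N + (m + 1) = N + m + 1 by ring, Nat.factorial_succ, Nat.factorial_succ]
    push_cast
    field_simp

lemma leRoyC_scaled (s : ℝ) (m N : ℕ) :
    leRoyC s m N * ((m : ℝ) ^ s) ^ N = (leRoyE m N) ^ s * (N.factorial : ℝ) ^ s := by
  have e : ((m : ℝ) ^ s) ^ N = ((m : ℝ) ^ N) ^ s := by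
    rw [← Real.rpow_natCast, ← Real.rpow_natCast, ← Real.rpow_mul (by positivity),
      ← Real.rpow_mul (by positivity), mul_comm]
  rw [e, leRoyC_eq, ← Real.mul_rpow (by positivity) (by positivity),
    ← Real.mul_rpow (leRoyE_nonneg _ _) (by positivity)]
  congr 1
  unfold leRoyE
  ring

lemma leRoyG_nonneg {s : ℝ} (hs : 0 < s) (hs1 : s < 1) (j : ℕ) (x : ℝ) :
    0 ≤ leRoyG s j x := by
  have hlim : Tendsto (fun m : ℕ => ∑' n : ℕ, (leRoyE m (n + j)) ^ s *
      (((n + j).factorial : ℝ) ^ s * ((-x) ^ n / (n.factorial : ℝ)))) atTop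
      (𝓝 (leRoyG s j x)) := by
    unfold leRoyG
    refine tendsto_tsum_of_dominated_convergence
      (leRoyG_summable hs1 j (-x)).norm (fun n => ?_) (Eventually.of_forall fun m n => ?_)
    · have := ((leRoyE_tendsto (n + j)).rpow_const (p := s) (Or.inr hs.le)).mul_const
        (((n + j).factorial : ℝ) ^ s * ((-x) ^ n / (n.factorial : ℝ)))
      simpa using this
    · rw [norm_mul]
      refine mul_le_of_le_one_left (norm_nonneg _) ?_
      rw [Real.norm_of_nonneg (Real.rpow_nonneg (leRoyE_nonneg _ _) _)]
      exact Real.rpow_le_one (leRoyE_nonneg _ _) (leRoyE_le_one _ _) hs.le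
  refine ge_of_tendsto' hlim fun m => ?_
  have e : ∀ n : ℕ, (leRoyE m (n + j)) ^ s *
      (((n + j).factorial : ℝ) ^ s * ((-x) ^ n / (n.factorial : ℝ))) = ((m : ℝ) ^ s) ^ j *
      (leRoyC s m (n + j) * ((-((m : ℝ) ^ s * x)) ^ n / (n.factorial : ℝ))) := by
    intro n
    rw [← mul_assoc, ← leRoyC_scaled, ← mul_neg, mul_pow, pow_add]
    ring
  simp only [e]
  rw [tsum_mul_left]
  exact mul_nonneg (by positivity) (leRoyC_pos hs m j _)

lemma leRoyG_zero_nonneg (j : ℕ) (x : ℝ) : 0 ≤ leRoyG 0 j x := by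
  unfold leRoyG
  simp only [Real.rpow_zero, one_mul]
  have : Real.exp (-x) = ∑' n : ℕ, (-x) ^ n / (n.factorial : ℝ) := by
    rw [Real.exp_eq_exp_ℝ, NormedSpace.exp_eq_tsum_div]
  rw [← this]; positivity

theorem leRoy_completelyMonotone_iff (α : ℝ) (hα : 0 < α) :
    CompletelyMonotoneOn (fun x => leRoy α (-x)) ↔ α ≤ 1 := by
  rw [leRoy_cm_iff hα]
  constructor
  · intro h
    by_contra! hlt
    exact leRoyG_not_nonneg (by linarith) h
  · intro hle n x _
    rcases hle.lt_or_eq with h | h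
    · exact leRoyG_nonneg (by linarith) (by linarith) n x
    · rw [h, sub_self]; exact leRoyG_zero_nonneg n x
end

section
/- For every 0 < α ≤ β ≤ 1 and every x ∈ ℝ, one has L_β(x) ≤ L_α(x). -/
open MeasureTheory ProbabilityTheory Filter Topology

/-- Coefficients of an everywhere convergent power series with convex sum. -/
def LRGood (a : ℕ → ℝ) : Prop :=
  (∀ x : ℝ, Summable fun n => a n * x ^ n) ∧
    ConvexOn ℝ Set.univ (fun x : ℝ => ∑' n, a n * x ^ n)

lemma LRGood.step_measure {a : ℕ → ℝ} (ha : LRGood a) (μ : Measure ℝ) [IsProbabilityMeasure μ]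
    (y : ℝ → ℝ) (hy : Measurable y) (C : ℝ) (hC : ∀ᵐ t ∂μ, |y t| ≤ C) (c : ℕ → ℝ)
    (hc : ∀ n, ∫ t, y t ^ n ∂μ = c n) (hc1 : c 1 = 1) :
    LRGood (fun n => a n * c n) ∧
      ∀ x : ℝ, ∑' n, a n * x ^ n ≤ ∑' n, (a n * c n) * x ^ n := by
  set f : ℝ → ℝ := fun x => ∑' n, a n * x ^ n with hf
  have hcont : Continuous f := by
    have := ha.2.continuousOn isOpen_univ
    exact continuousOn_univ.1 this
  have hbd : ∀ x : ℝ, ∀ n, ∀ᵐ t ∂μ, ‖a n * (x * y t) ^ n‖ ≤ ‖a n * (x * C) ^ n‖ := by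
    intro x n
    filter_upwards [hC] with t ht
    have hC0 : 0 ≤ C := (abs_nonneg _).trans ht
    simp only [norm_mul, norm_pow, Real.norm_eq_abs, abs_of_nonneg hC0]
    gcongr
  have hsumm : ∀ x : ℝ, Summable fun n => ‖a n * (x * C) ^ n‖ := fun x => (ha.1 (x * C)).norm
  have hint : ∀ x : ℝ, Integrable (fun t => f (x * y t)) μ := by
    intro x
    refine Integrable.of_bound (C := ∑' n, ‖a n * (x * C) ^ n‖) ?_ ?_
    · exact (hcont.measurable.comp (hy.const_mul x)).aestronglyMeasurable
    · filter_upwards [ae_all_iff.2 (hbd x)] with t ht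
      exact tsum_of_norm_bounded (hsumm x).hasSum ht
  have hS : ∀ x : ℝ, HasSum (fun n => (a n * c n) * x ^ n) (∫ t, f (x * y t) ∂μ) := by
    intro x
    have h := hasSum_integral_of_dominated_convergence (μ := μ)
      (F := fun n t => a n * (x * y t) ^ n) (f := fun t => f (x * y t))
      (fun n _ => ‖a n * (x * C) ^ n‖)
      (fun n => by
        have : Measurable fun t => a n * (x * y t) ^ n := by fun_prop
        exact this.aestronglyMeasurable)
      (hbd x) (ae_of_all _ fun _ => hsumm x) (integrable_const _)
      (ae_of_all _ fun t => (ha.1 (x * y t)).hasSum)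
    have e : (fun n => (a n * c n) * x ^ n) = fun n => ∫ t, a n * (x * y t) ^ n ∂μ := by
      funext n
      simp_rw [mul_pow]
      rw [integral_const_mul, integral_const_mul, hc]
      ring
    rw [e]
    exact h
  have hyint : Integrable y μ :=
    Integrable.of_bound hy.aestronglyMeasurable C hC
  refine ⟨⟨fun x => (hS x).summable, ?_⟩, ?_⟩
  · have : (fun x : ℝ => ∑' n, (a n * c n) * x ^ n) = fun x => ∫ t, f (x * y t) ∂μ :=
      funext fun x => (hS x).tsum_eq
    show ConvexOn ℝ Set.univ (fun x : ℝ => ∑' n, (a n * c n) * x ^ n)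
    rw [this]
    refine ⟨convex_univ, ?_⟩
    intro u _ v _ p q hp hq hpq
    simp only [smul_eq_mul]
    rw [← integral_const_mul, ← integral_const_mul,
      ← integral_add ((hint u).const_mul p) ((hint v).const_mul q)]
    refine integral_mono (hint _) (((hint u).const_mul p).add ((hint v).const_mul q)) ?_
    intro t
    have := ha.2.2 (Set.mem_univ (u * y t)) (Set.mem_univ (v * y t)) hp hq hpq
    simp only [smul_eq_mul] at this
    show f ((p * u + q * v) * y t) ≤ p * f (u * y t) + q * f (v * y t)
    have e : (p * u + q * v) * y t = p * (u * y t) + q * (v * y t) := by ring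
    rw [e]; exact this
  · intro x
    rw [(hS x).tsum_eq]
    have h := ConvexOn.map_integral_le (μ := μ) (f := fun t => x * y t) ha.2
      hcont.continuousOn isClosed_univ (ae_of_all _ fun _ => Set.mem_univ _)
      (hyint.const_mul x) (hint x)
    have h1 := hc 1
    simp only [pow_one] at h1
    rw [integral_const_mul, h1, hc1, mul_one] at h
    exact h

/-- Weierstrass factor. -/
noncomputable def lrq (r : ℝ) (n : ℕ) : ℝ := (1 + 1 / r) ^ n / (1 + n / r)

lemma lrq_pos {r : ℝ} (hr : 0 < r) (n : ℕ) : 0 < lrq r n := by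
  unfold lrq; positivity

lemma gamma_exp_moment {δ r : ℝ} (hδ : 0 < δ) (hr : 0 < r) (n : ℕ) :
    ∫ t, Real.exp (-(n * t)) ∂(gammaMeasure δ r) = (1 / (1 + n / r)) ^ δ := by
  have hm : Measurable (gammaPDF δ r) := (measurable_gammaPDFReal δ r).ennreal_ofReal
  rw [gammaMeasure, integral_withDensity_eq_integral_toReal_smul hm
    (ae_of_all _ fun _ => ENNReal.ofReal_lt_top)]
  have e : (fun t => (gammaPDF δ r t).toReal • Real.exp (-(n * t))) =
      Set.indicator (Set.Ici 0)
        (fun t => r ^ δ / Real.Gamma δ * (t ^ (δ - 1) * Real.exp (-((r + n) * t)))) := by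
    funext t
    rw [gammaPDF, ENNReal.toReal_ofReal (gammaPDFReal_nonneg hδ hr t), gammaPDFReal]
    by_cases ht : 0 ≤ t
    · rw [if_pos ht, Set.indicator_of_mem (by exact ht), smul_eq_mul,
        show -((r + n) * t) = -(r * t) + -(n * t) by ring, Real.exp_add]
      ring
    · rw [if_neg ht, Set.indicator_of_notMem (by exact ht), zero_smul]
  rw [e, integral_indicator measurableSet_Ici, integral_Ici_eq_integral_Ioi, integral_const_mul,
    Real.integral_rpow_mul_exp_neg_mul_Ioi hδ (by positivity)]
  have hG := (Real.Gamma_pos_of_pos hδ).ne'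
  have : (1 / (1 + n / r)) = r * (1 / (r + n)) := by field_simp
  rw [this, Real.mul_rpow hr.le (by positivity)]
  field_simp

lemma LRGood.step {a : ℕ → ℝ} (ha : LRGood a) {δ r : ℝ} (hδ : 0 ≤ δ) (hr : 0 < r) :
    LRGood (fun n => a n * lrq r n ^ δ) ∧
      ∀ x : ℝ, ∑' n, a n * x ^ n ≤ ∑' n, (a n * lrq r n ^ δ) * x ^ n := by
  rcases hδ.eq_or_lt with rfl | hδ
  · simpa using ha
  have := isProbabilityMeasure_gammaMeasure hδ hr
  have hm : Measurable (gammaPDF δ r) := (measurable_gammaPDFReal δ r).ennreal_ofReal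
  refine ha.step_measure (gammaMeasure δ r) (fun t => (1 + 1 / r) ^ δ * Real.exp (-t))
    (by fun_prop) ((1 + 1 / r) ^ δ) ?_ _ ?_ ?_
  · rw [gammaMeasure, ae_withDensity_iff hm]
    refine ae_of_all _ fun t ht => ?_
    have ht0 : 0 ≤ t := by
      by_contra h
      exact ht (gammaPDF_of_neg (not_le.1 h))
    rw [abs_of_nonneg (by positivity)]
    have : Real.exp (-t) ≤ 1 := Real.exp_le_one_iff.2 (by linarith)
    exact mul_le_of_le_one_right (by positivity) this
  · intro n
    have e : ∀ t : ℝ, ((1 + 1 / r) ^ δ * Real.exp (-t)) ^ n =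
        ((1 + 1 / r) ^ δ) ^ n * Real.exp (-(n * t)) := by
      intro t
      rw [mul_pow, ← Real.exp_nat_mul]
      congr 2; ring
    simp_rw [e]
    rw [integral_const_mul, gamma_exp_moment hδ hr, lrq, div_eq_mul_one_div ((1 + 1 / r) ^ n),
      Real.mul_rpow (by positivity) (by positivity), ← Real.rpow_natCast, ← Real.rpow_natCast,
      ← Real.rpow_mul (by positivity), ← Real.rpow_mul (by positivity), mul_comm δ]
  · have : lrq r 1 = 1 := by
      unfold lrq
      have : (1 + 1 / r) ≠ 0 := by positivity
      simp only [pow_one, Nat.cast_one]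
      exact div_self this
    rw [this, Real.one_rpow]

/-- Partial products. -/
noncomputable def lrp (N n : ℕ) : ℝ := ∏ k ∈ Finset.range N, lrq ((k : ℝ) + 1) n

lemma lrp_pos (N n : ℕ) : 0 < lrp N n :=
  Finset.prod_pos fun _ _ => lrq_pos (by positivity) _

lemma LRGood.iter {a : ℕ → ℝ} (ha : LRGood a) {δ : ℝ} (hδ : 0 ≤ δ) (N : ℕ) :
    LRGood (fun n => a n * lrp N n ^ δ) ∧
      ∀ x : ℝ, ∑' n, a n * x ^ n ≤ ∑' n, (a n * lrp N n ^ δ) * x ^ n := by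
  induction N with
  | zero => simpa [lrp] using ha
  | succ N ih =>
    have h := ih.1.step hδ (r := (N : ℝ) + 1) (by positivity)
    have e : ∀ n, a n * lrp N n ^ δ * lrq ((N : ℝ) + 1) n ^ δ = a n * lrp (N + 1) n ^ δ := by
      intro n
      rw [mul_assoc, ← Real.mul_rpow (lrp_pos _ _).le (lrq_pos (by positivity) _).le, lrp, lrp,
        Finset.prod_range_succ]
    simp only [e] at h
    exact ⟨h.1, fun x => (ih.2 x).trans (h.2 x)⟩

lemma lrp_eq (N n : ℕ) :
    lrp N n = ((N : ℝ) + 1) ^ n * N.factorial * n.factorial / (N + n).factorial := by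
  induction N with
  | zero => simp [lrp, (Nat.factorial_pos n).ne']
  | succ N ih =>
    have : lrp (N + 1) n = lrp N n * lrq ((N : ℝ) + 1) n := by
      rw [lrp, lrp, Finset.prod_range_succ]
    rw [this, ih, lrq, show N + 1 + n = (N + n) + 1 by ring, Nat.factorial_succ, Nat.factorial_succ]
    have h1 : (1 + 1 / ((N : ℝ) + 1)) = ((N : ℝ) + 1 + 1) / (N + 1) := by field_simp
    rw [h1, div_pow]
    push_cast
    have h2 : ((N + n).factorial : ℝ) ≠ 0 := by positivity
    field_simp
    ring

lemma lrp_le (N n : ℕ) : lrp N n ≤ n.factorial := by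
  rw [lrp_eq, div_le_iff₀ (by positivity)]
  have h : ((N.factorial * (N + 1) ^ n : ℕ) : ℝ) ≤ ((N + n).factorial : ℕ) :=
    Nat.cast_le.2 Nat.factorial_mul_pow_le_factorial
  push_cast at h
  have : (0 : ℝ) ≤ n.factorial := by positivity
  nlinarith

lemma lrp_tendsto (n : ℕ) : Tendsto (fun N => lrp N n) atTop (𝓝 (n.factorial : ℝ)) := by
  induction n with
  | zero =>
    refine tendsto_const_nhds.congr fun N => ?_
    have : (N.factorial : ℝ) ≠ 0 := by positivity
    rw [lrp_eq]
    simp [this]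
  | succ n ih =>
    have h1 : Tendsto (fun N : ℕ => 1 - (n : ℝ) * (1 / ((N + n : ℕ) + 1 : ℝ))) atTop
        (𝓝 (1 - n * 0)) := by
      refine tendsto_const_nhds.sub (Tendsto.const_mul _ ?_)
      exact (tendsto_one_div_add_atTop_nhds_zero_nat (𝕜 := ℝ)).comp (tendsto_add_atTop_nat n)
    have h2 := (ih.mul_const ((n : ℝ) + 1)).mul h1
    have e : (n.factorial : ℝ) * ((n : ℝ) + 1) * (1 - n * 0) = ((n + 1).factorial : ℝ) := by
      rw [Nat.factorial_succ]; push_cast; ring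
    rw [e] at h2
    refine h2.congr fun N => ?_
    rw [lrp_eq, lrp_eq, show N + (n + 1) = (N + n) + 1 by ring, Nat.factorial_succ,
      Nat.factorial_succ]
    push_cast
    have h3 : ((N + n).factorial : ℝ) ≠ 0 := by positivity
    have h4 : (N : ℝ) + n + 1 ≠ 0 := by positivity
    field_simp
    ring

lemma lr_summable {α : ℝ} (hα : 0 < α) (x : ℝ) :
    Summable fun n : ℕ => |x| ^ n / (n.factorial : ℝ) ^ α := by
  have h : Summable fun n : ℕ => (|x| + 1) ^ n / (n.factorial : ℝ) ^ α := by
    refine summable_of_ratio_test_tendsto_lt_one (l := 0) one_pos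
      (Eventually.of_forall fun n => by positivity) ?_
    have h1 : Tendsto (fun n : ℕ => (|x| + 1) / ((n : ℝ) + 1) ^ α) atTop (𝓝 0) := by
      refine Tendsto.const_div_atTop ?_ _
      refine (tendsto_rpow_atTop hα).comp ?_
      exact tendsto_atTop_add_const_right _ _ tendsto_natCast_atTop_atTop
    refine h1.congr fun n => ?_
    rw [Real.norm_of_nonneg (by positivity), Real.norm_of_nonneg (by positivity),
      Nat.factorial_succ, Nat.cast_mul, Real.mul_rpow (by positivity) (by positivity), pow_succ]
    have h3 : (n.factorial : ℝ) ^ α ≠ 0 := by positivity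
    have h4 : ((n : ℝ) + 1) ^ α ≠ 0 := by positivity
    have h5 : |x| + 1 ≠ 0 := by positivity
    push_cast
    field_simp
  refine h.of_nonneg_of_le (fun n => by positivity) fun n => ?_
  gcongr
  linarith

lemma lr_good_exp : LRGood (fun n => 1 / (n.factorial : ℝ)) := by
  have h : ∀ x : ℝ, HasSum (fun n : ℕ => 1 / (n.factorial : ℝ) * x ^ n) (Real.exp x) := by
    intro x
    have := NormedSpace.expSeries_div_hasSum_exp x
    rw [← Real.exp_eq_exp_ℝ] at this
    have e : (fun n : ℕ => 1 / (n.factorial : ℝ) * x ^ n) = fun n => x ^ n / n.factorial := by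
      funext n
      ring
    rw [e]
    exact this
  refine ⟨fun x => (h x).summable, ?_⟩
  have : (fun x : ℝ => ∑' n : ℕ, 1 / (n.factorial : ℝ) * x ^ n) = Real.exp :=
    funext fun x => (h x).tsum_eq
  rw [this]
  exact convexOn_exp

lemma lr_limit {α : ℝ} (hα : 0 < α) (hα1 : α ≤ 1) (x : ℝ) :
    Tendsto (fun N => ∑' n : ℕ, (1 / (n.factorial : ℝ) * lrp N n ^ (1 - α)) * x ^ n) atTop
      (𝓝 (leRoy α x)) := by
  have e : ∀ n : ℕ, 1 / (n.factorial : ℝ) * (n.factorial : ℝ) ^ (1 - α) =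
      1 / (n.factorial : ℝ) ^ α := by
    intro n
    have h3 : (0 : ℝ) < n.factorial := by positivity
    rw [Real.rpow_sub h3, Real.rpow_one]
    field_simp
  unfold leRoy
  refine tendsto_tsum_of_dominated_convergence (lr_summable hα x) ?_ ?_
  · intro n
    have h := (((lrp_tendsto n).rpow_const (p := 1 - α)
      (Or.inr (by linarith))).const_mul (1 / (n.factorial : ℝ))).mul_const (x ^ n)
    rw [e] at h
    convert h using 2
    ring
  · refine Eventually.of_forall fun N n => ?_
    have hp := lrp_pos N n
    rw [norm_mul, norm_pow, Real.norm_eq_abs x, Real.norm_of_nonneg (by positivity)]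
    have : 1 / (n.factorial : ℝ) * lrp N n ^ (1 - α) ≤ 1 / (n.factorial : ℝ) ^ α := by
      rw [← e]
      exact mul_le_mul_of_nonneg_left
        (Real.rpow_le_rpow hp.le (lrp_le N n) (by linarith)) (by positivity)
    calc _ ≤ 1 / (n.factorial : ℝ) ^ α * |x| ^ n := by gcongr
      _ = _ := by ring

theorem leRoy_antitone (α β x : ℝ) (hα : 0 < α) (hαβ : α ≤ β) (hβ : β ≤ 1) :
    leRoy β x ≤ leRoy α x := by
  refine le_of_tendsto_of_tendsto' (lr_limit (hα.trans_le hαβ) hβ x)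
    (lr_limit hα (hαβ.trans hβ) x) fun N => ?_
  have h1 := (lr_good_exp.iter (δ := 1 - β) (by linarith) N).1
  have h2 := (h1.iter (δ := β - α) (by linarith) N).2 x
  have e : ∀ n : ℕ, 1 / (n.factorial : ℝ) * lrp N n ^ (1 - β) * lrp N n ^ (β - α) =
      1 / (n.factorial : ℝ) * lrp N n ^ (1 - α) := by
    intro n
    rw [mul_assoc, ← Real.rpow_add (lrp_pos N n)]
    congr 2; ring
  simp only [e] at h2
  exact h2
end

section
/- For every α ∈ (0,1] and every x ∈ ℝ, one has e^x ≤ L_α(x); moreover, if x < 1 then L_α(x) ≤ 1/(1−x). -/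
open MeasureTheory Filter Topology

/-- Exponential generating function of `a` at `-t`. -/
noncomputable def egf (a : ℕ → ℝ) (t : ℝ) : ℝ := ∑' n : ℕ, a n * (-t) ^ n / (n.factorial : ℝ)

structure GoodSeq (a : ℕ → ℝ) : Prop where
  summ : ∀ r : ℝ, Summable (fun n : ℕ => |a n| * |r| ^ n / (n.factorial : ℝ))
  conv : ConvexOn ℝ (Set.Ici 0) (egf a)
  anti : AntitoneOn (egf a) (Set.Ici 0)

theorem egf_continuous {a : ℕ → ℝ}
    (h : ∀ r : ℝ, Summable (fun n : ℕ => |a n| * |r| ^ n / (n.factorial : ℝ))) :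
    Continuous (egf a) := by
  rw [continuous_iff_continuousAt]
  intro x
  have hc : ContinuousOn (egf a) (Set.Icc (-(|x| + 1)) (|x| + 1)) := by
    refine continuousOn_tsum (fun n => by fun_prop) (h (|x| + 1)) ?_
    intro n y hy
    have : |y| ≤ |(|x| + 1)| := by
      rw [abs_of_nonneg (by positivity : (0 : ℝ) ≤ |x| + 1)]
      exact abs_le.2 hy
    rw [Real.norm_eq_abs, abs_div, abs_mul, abs_pow, abs_neg, Nat.abs_cast]
    gcongr
  refine hc.continuousAt (Icc_mem_nhds ?_ ?_)
  · linarith [neg_abs_le x]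
  · linarith [le_abs_self x]

theorem egf_integrable {a : ℕ → ℝ}
    (h : ∀ r : ℝ, Summable (fun n : ℕ => |a n| * |r| ^ n / (n.factorial : ℝ)))
    (μ : Measure ℝ) [IsProbabilityMeasure μ] (U : ℝ → ℝ) (hU : Continuous U)
    (hU0 : ∀ g, 0 ≤ U g) (hU1 : ∀ g, U g ≤ 1) (t : ℝ) :
    Integrable (fun g => egf a (t * U g)) μ := by
  obtain ⟨C, hC⟩ := (isCompact_Icc (a := -|t|) (b := |t|)).exists_bound_of_continuousOn
    (egf_continuous h).continuousOn
  refine Integrable.of_bound (C := C) ?_ ?_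
  · exact ((egf_continuous h).comp (continuous_const.mul hU)).aestronglyMeasurable
  · refine ae_of_all _ fun g => hC _ (abs_le.1 ?_)
    rw [abs_mul, abs_of_nonneg (hU0 g)]
    exact mul_le_of_le_one_right (abs_nonneg _) (hU1 g)

theorem egf_integral {a m : ℕ → ℝ}
    (h : ∀ r : ℝ, Summable (fun n : ℕ => |a n| * |r| ^ n / (n.factorial : ℝ)))
    (μ : Measure ℝ) [IsProbabilityMeasure μ] (U : ℝ → ℝ) (hU : Continuous U)
    (hU0 : ∀ g, 0 ≤ U g) (hU1 : ∀ g, U g ≤ 1) (hm : ∀ n, ∫ g, U g ^ n ∂μ = m n) (t : ℝ) :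
    egf (fun n => a n * m n) t = ∫ g, egf a (t * U g) ∂μ := by
  have hb : ∀ n g, ‖a n * (-(t * U g)) ^ n / (n.factorial : ℝ)‖
      ≤ |a n| * |t| ^ n / (n.factorial : ℝ) := by
    intro n g
    rw [Real.norm_eq_abs, abs_div, abs_mul, abs_pow, abs_neg, Nat.abs_cast, abs_mul,
      abs_of_nonneg (hU0 g)]
    have h0 := mul_nonneg (abs_nonneg t) (hU0 g)
    have h1 := mul_le_of_le_one_right (abs_nonneg t) (hU1 g)
    gcongr
  have hi : ∀ n, Integrable (fun g => a n * (-(t * U g)) ^ n / (n.factorial : ℝ)) μ := by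
    intro n
    refine Integrable.of_bound (C := |a n| * |t| ^ n / (n.factorial : ℝ)) ?_ ?_
    · exact Continuous.aestronglyMeasurable (by fun_prop)
    · exact ae_of_all _ (hb n)
  have := integral_tsum_of_summable_integral_norm hi ?_
  · unfold egf
    rw [← this]
    congr 1
    ext n
    beta_reduce
    rw [← hm n]
    have : ∀ g, a n * (-(t * U g)) ^ n / (n.factorial : ℝ)
        = (a n * (-t) ^ n / (n.factorial : ℝ)) * U g ^ n := by
      intro g
      rw [← neg_mul, mul_pow]; ring
    simp_rw [this]
    rw [integral_const_mul]; ring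
  · refine Summable.of_nonneg_of_le (fun n => integral_nonneg fun g => norm_nonneg _) ?_ (h t)
    intro n
    calc _ ≤ ∫ g, |a n| * |t| ^ n / (n.factorial : ℝ) ∂μ :=
          integral_mono (hi n).norm (integrable_const _) (hb n)
      _ = _ := by simp

theorem good_mul {a m : ℕ → ℝ} (h : GoodSeq a)
    (μ : Measure ℝ) [IsProbabilityMeasure μ] (U : ℝ → ℝ) (hU : Continuous U)
    (hU0 : ∀ g, 0 ≤ U g) (hU1 : ∀ g, U g ≤ 1) (hm : ∀ n, ∫ g, U g ^ n ∂μ = m n) :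
    GoodSeq (fun n => a n * m n) ∧
    (∀ t, 0 ≤ t → egf a t ≤ egf (fun n => a n * m n) t) ∧
    (∀ t, 0 ≤ t → egf a (t * m 1) ≤ egf (fun n => a n * m n) t) := by
  have hE := egf_integral h.summ μ U hU hU0 hU1 hm
  have hI := egf_integrable h.summ μ U hU hU0 hU1
  have hUi : ∀ n, Integrable (fun g => U g ^ n) μ := fun n => by
    refine Integrable.of_bound (C := 1) (hU.pow n).aestronglyMeasurable (ae_of_all _ fun g => ?_)
    rw [Real.norm_eq_abs, abs_of_nonneg (pow_nonneg (hU0 g) n)]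
    exact pow_le_one₀ (hU0 g) (hU1 g)
  have hm0 : ∀ n, 0 ≤ m n := fun n => by
    rw [← hm]; exact integral_nonneg fun g => pow_nonneg (hU0 g) n
  have hm1 : ∀ n, m n ≤ 1 := fun n => by
    rw [← hm]
    calc _ ≤ ∫ g, (1 : ℝ) ∂μ :=
          integral_mono (hUi n) (integrable_const _) (fun g => pow_le_one₀ (hU0 g) (hU1 g))
      _ = 1 := by simp
  refine ⟨⟨?_, ?_, ?_⟩, ?_, ?_⟩
  · intro r
    refine Summable.of_nonneg_of_le (fun n => by positivity) (fun n => ?_) (h.summ r)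
    rw [abs_mul, abs_of_nonneg (hm0 n)]
    gcongr
    exact mul_le_of_le_one_right (abs_nonneg _) (hm1 n)
  · refine ⟨convex_Ici 0, ?_⟩
    intro x hx y hy p q hp hq hpq
    rw [hE, hE, hE]
    simp only [smul_eq_mul]
    rw [← integral_const_mul, ← integral_const_mul,
      ← integral_add ((hI x).const_mul p) ((hI y).const_mul q)]
    refine integral_mono (hI _) (((hI x).const_mul p).add ((hI y).const_mul q)) fun g => ?_
    have := h.conv.2 (x := x * U g) (mul_nonneg hx (hU0 g)) (y := y * U g)
      (mul_nonneg hy (hU0 g)) hp hq hpq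
    simp only [smul_eq_mul, Pi.add_apply] at this ⊢
    convert this using 2
    ring
  · intro x hx y hy hxy
    rw [hE, hE]
    refine integral_mono (hI _) (hI _) fun g => ?_
    exact h.anti (mul_nonneg hx (hU0 g)) (mul_nonneg hy (hU0 g))
      (mul_le_mul_of_nonneg_right hxy (hU0 g))
  · intro t ht
    rw [hE]
    calc egf a t = ∫ g, egf a t ∂μ := by simp
      _ ≤ _ := integral_mono (integrable_const _) (hI _) fun g =>
        h.anti (mul_nonneg ht (hU0 g)) ht (mul_le_of_le_one_right ht (hU1 g))
  · intro t ht
    rw [hE, ← hm 1]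
    simp only [pow_one]
    rw [← integral_const_mul]
    refine h.conv.map_integral_le (egf_continuous h.summ).continuousOn isClosed_Ici
      (ae_of_all _ fun g => mul_nonneg ht (hU0 g)) ?_ (hI t)
    have := (hUi 1).const_mul t
    simpa using this

theorem gamma_moment {s k : ℝ} (hs : 0 < s) (hk : 0 < k) (n : ℕ) :
    ∫ g, Real.exp (-|g|) ^ n ∂(ProbabilityTheory.gammaMeasure s k) = (k / (n + k)) ^ s := by
  have hnk : (0 : ℝ) < n + k := by positivity
  rw [ProbabilityTheory.gammaMeasure, integral_withDensity_eq_integral_toReal_smul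
    (by unfold ProbabilityTheory.gammaPDF; fun_prop)
    (ae_of_all _ fun x => by unfold ProbabilityTheory.gammaPDF; exact ENNReal.ofReal_lt_top)]
  have h1 : ∀ x : ℝ, (ProbabilityTheory.gammaPDF s k x).toReal • Real.exp (-|x|) ^ n
      = (Set.Ici (0 : ℝ)).indicator (fun x => k ^ s / Real.Gamma s *
        (x ^ (s - 1) * Real.exp (-((n + k) * x)))) x := by
    intro x
    unfold ProbabilityTheory.gammaPDF
    rw [ENNReal.toReal_ofReal (ProbabilityTheory.gammaPDFReal_nonneg hs hk x)]
    unfold ProbabilityTheory.gammaPDFReal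
    by_cases hx : 0 ≤ x
    · rw [if_pos hx, Set.indicator_of_mem (Set.mem_Ici.2 hx), abs_of_nonneg hx, smul_eq_mul,
        ← Real.exp_nat_mul]
      have : Real.exp (-((n + k) * x)) = Real.exp (-(k * x)) * Real.exp (n * -x) := by
        rw [← Real.exp_add]; ring_nf
      rw [this]; ring
    · rw [if_neg hx, Set.indicator_of_notMem (by simpa using hx), zero_smul]
  simp_rw [h1]
  rw [integral_indicator measurableSet_Ici, integral_Ici_eq_integral_Ioi, integral_const_mul,
    Real.integral_rpow_mul_exp_neg_mul_Ioi hs hnk, div_eq_mul_one_div k, Real.mul_rpow hk.le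
    (by positivity)]
  have := (Real.Gamma_pos_of_pos hs).ne'
  field_simp

theorem good_factor {a : ℕ → ℝ} (h : GoodSeq a) {s k : ℝ} (hs : 0 < s) (hk : 0 < k) :
    GoodSeq (fun n => a n * (k / (n + k)) ^ s) ∧
    (∀ t, 0 ≤ t → egf a t ≤ egf (fun n => a n * (k / (n + k)) ^ s) t) ∧
    (∀ t, 0 ≤ t → egf a (t * (k / ((1 : ℕ) + k)) ^ s) ≤ egf (fun n => a n * (k / (n + k)) ^ s) t) := by
  haveI := ProbabilityTheory.isProbabilityMeasure_gammaMeasure hs hk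
  exact good_mul h (ProbabilityTheory.gammaMeasure s k) (fun g => Real.exp (-|g|)) (by fun_prop)
    (fun g => (Real.exp_pos _).le) (fun g => Real.exp_le_one_iff.2 (by simp))
    (gamma_moment hs hk)

theorem egf_scale (a : ℕ → ℝ) (c t : ℝ) : egf (fun n => c ^ n * a n) t = egf a (c * t) := by
  unfold egf
  congr 1
  ext n
  rw [← mul_neg, mul_pow]; ring

theorem good_scale {a : ℕ → ℝ} (h : GoodSeq a) {c : ℝ} (hc : 0 ≤ c) :
    GoodSeq (fun n => c ^ n * a n) := by
  refine ⟨?_, ?_, ?_⟩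
  · intro r
    convert h.summ (c * r) using 2 with n
    rw [abs_mul, abs_mul, mul_pow, abs_pow]; ring
  · refine ⟨convex_Ici 0, ?_⟩
    intro x hx y hy p q hp hq hpq
    rw [egf_scale, egf_scale, egf_scale]
    have := h.conv.2 (x := c * x) (mul_nonneg hc hx) (y := c * y) (mul_nonneg hc hy) hp hq hpq
    simp only [smul_eq_mul] at this ⊢
    convert this using 2
    ring
  · intro x hx y hy hxy
    rw [egf_scale, egf_scale]
    exact h.anti (mul_nonneg hc hx) (mul_nonneg hc hy) (mul_le_mul_of_nonneg_left hxy hc)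

/-- Finite Gauss product for `n!`. -/
noncomputable def gaussP (N n : ℕ) : ℝ :=
  ∏ j ∈ Finset.range n, ((j + 1 : ℝ) * ((N + 1) / (N + j + 1)))

theorem gaussP_pos (N n : ℕ) : 0 < gaussP N n :=
  Finset.prod_pos fun j _ => by positivity

theorem gaussP_zero (n : ℕ) : gaussP 0 n = 1 := by
  refine Finset.prod_eq_one fun j _ => ?_
  have : (j + 1 : ℝ) ≠ 0 := by positivity
  simp only [Nat.cast_zero, zero_add]
  field_simp

theorem fact_prod (n : ℕ) : (n.factorial : ℝ) = ∏ j ∈ Finset.range n, (j + 1 : ℝ) := by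
  rw [← Finset.prod_range_add_one_eq_factorial]; push_cast; rfl

theorem gaussP_le (N n : ℕ) : gaussP N n ≤ n.factorial := by
  rw [fact_prod]
  refine Finset.prod_le_prod (fun j _ => by positivity) fun j _ => ?_
  refine mul_le_of_le_one_right (by positivity) ?_
  rw [div_le_one (by positivity)]
  have : (0 : ℝ) ≤ j := by positivity
  linarith

theorem gaussP_tendsto (n : ℕ) : Tendsto (fun N => gaussP N n) atTop (𝓝 (n.factorial : ℝ)) := by
  rw [fact_prod]
  refine tendsto_finsetProd _ fun j _ => ?_
  have h := tendsto_const_nhds (x := (1 : ℝ)).sub ((tendsto_const_div_atTop_nhds_zero_nat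
    (j : ℝ)).comp (tendsto_add_atTop_nat (j + 1)))
  have h2 := h.const_mul (j + 1 : ℝ)
  simp only [sub_zero, mul_one] at h2
  refine h2.congr fun N => ?_
  have : (N + j + 1 : ℝ) ≠ 0 := by positivity
  simp only [Function.comp]
  push_cast
  rw [← add_assoc]
  field_simp
  ring

theorem gaussP_succ (N n : ℕ) : gaussP (N + 1) n =
    ((N + 2 : ℝ) / (N + 1)) ^ n * (gaussP N n * ((N + 1) / (n + (N + 1)))) := by
  induction n with
  | zero =>
    have : (N + 1 : ℝ) ≠ 0 := by positivity
    simp [gaussP, div_self this]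
  | succ n ih =>
    have e : ∀ M, gaussP M (n + 1) = gaussP M n * ((n + 1 : ℝ) * ((M + 1) / (M + n + 1))) :=
      fun M => Finset.prod_range_succ _ _
    rw [e, e, ih, pow_succ]
    have h1 : (N + 1 : ℝ) ≠ 0 := by positivity
    have h2 : (N + n + 1 : ℝ) ≠ 0 := by positivity
    have h3 : (N + n + 2 : ℝ) ≠ 0 := by positivity
    have h4 : (n + (N + 1) : ℝ) = N + n + 1 := by ring
    have h5 : (N + 1 + n + 1 : ℝ) = N + n + 2 := by ring
    have h6 : (n + 1 + (N + 1) : ℝ) = N + n + 2 := by ring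
    push_cast
    rw [h4, h5, h6]
    field_simp
    ring

theorem good_gauss {a : ℕ → ℝ} (h : GoodSeq a) {s : ℝ} (hs : 0 ≤ s) (N : ℕ) :
    GoodSeq (fun n => a n * gaussP N n ^ s) ∧
    ∀ t, 0 ≤ t → egf a t ≤ egf (fun n => a n * gaussP N n ^ s) t := by
  rcases hs.eq_or_lt with rfl | hs
  · simpa using h
  induction N with
  | zero => simpa [gaussP_zero] using h
  | succ N ih =>
    obtain ⟨ih1, ih2⟩ := ih
    have hk : (0 : ℝ) < N + 1 := by positivity
    obtain ⟨f1, -, f3⟩ := good_factor ih1 hs hk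
    set c : ℝ := ((N + 2 : ℝ) / (N + 1)) ^ s with hc
    have hc0 : 0 < c := by positivity
    have key : (fun n => a n * gaussP (N + 1) n ^ s) = fun n : ℕ =>
        c ^ n * (a n * gaussP N n ^ s * ((N + 1 : ℝ) / (n + (N + 1))) ^ s) := by
      ext n
      have := (gaussP_pos N n).le
      rw [gaussP_succ, Real.mul_rpow (by positivity) (by positivity),
        Real.mul_rpow (by positivity) (by positivity), hc, ← Real.rpow_natCast,
        ← Real.rpow_natCast, ← Real.rpow_mul (by positivity), ← Real.rpow_mul (by positivity),
        mul_comm (n : ℝ) s]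
      ring
    rw [key]
    refine ⟨good_scale f1 hc0.le, fun t ht => (ih2 t ht).trans ?_⟩
    rw [egf_scale]
    refine le_trans (le_of_eq ?_) (f3 (c * t) (by positivity))
    congr 1
    have : c * ((N + 1 : ℝ) / ((1 : ℕ) + (N + 1))) ^ s = 1 := by
      rw [hc, ← Real.mul_rpow (by positivity) (by positivity)]
      have : (N + 2 : ℝ) / (N + 1) * ((N + 1 : ℝ) / ((1 : ℕ) + (N + 1))) = 1 := by
        have : (N + 2 : ℝ) ≠ 0 := by positivity
        have h' : ((1 : ℕ) + (N + 1) : ℝ) = N + 2 := by push_cast; ring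
        rw [h']
        field_simp
      rw [this, Real.one_rpow]
    linear_combination (-t) * this

theorem egf_one (t : ℝ) : egf (fun _ => 1) t = Real.exp (-t) := by
  rw [Real.exp_eq_exp_ℝ, NormedSpace.exp_eq_tsum_div]
  simp [egf]

theorem good_one : GoodSeq (fun _ => 1) := by
  refine ⟨?_, ?_, ?_⟩
  · intro r
    simpa using Real.summable_pow_div_factorial |r|
  · have : egf (fun _ => 1) = fun t => Real.exp (-t) := funext egf_one
    rw [this]
    refine ⟨convex_Ici 0, ?_⟩
    intro x _ y _ p q hp hq hpq
    have := convexOn_exp.2 (Set.mem_univ (-x)) (Set.mem_univ (-y)) hp hq hpq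
    simp only [smul_eq_mul] at this ⊢
    convert this using 2
    ring
  · intro x _ y _ hxy
    rw [egf_one, egf_one]
    exact Real.exp_le_exp.2 (by linarith)

theorem egf_gauss_le (N : ℕ) (h : GoodSeq (gaussP N)) {t : ℝ} (ht : 0 ≤ t) :
    egf (gaussP N) t ≤ 1 / (1 + t) := by
  have hk : (0 : ℝ) < N + 1 := by positivity
  obtain ⟨-, f2, -⟩ := good_factor h one_pos hk
  have f := f2 t ht
  have hs : Summable (fun n : ℕ => gaussP N n * (-t) ^ n / (n.factorial : ℝ)) := by
    refine Summable.of_norm ?_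
    convert h.summ t using 2 with n
    rw [Real.norm_eq_abs, abs_div, abs_mul, abs_pow, abs_neg, Nat.abs_cast]
  have e : egf (gaussP N) t
      = 1 - t * egf (fun n => gaussP N n * ((N + 1 : ℝ) / (n + (N + 1))) ^ (1 : ℝ)) t := by
    conv_lhs => unfold egf
    rw [hs.tsum_eq_zero_add]
    unfold egf
    rw [← tsum_mul_left, sub_eq_add_neg, ← tsum_neg]
    congr 1
    · simp [gaussP]
    · congr 1
      ext n
      beta_reduce
      rw [gaussP, Finset.prod_range_succ, ← gaussP, Real.rpow_one, Nat.factorial_succ]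
      have h4 : (n + (N + 1) : ℝ) = N + n + 1 := by ring
      have h5 : (N + n + 1 : ℝ) ≠ 0 := by positivity
      have h6 : (n.factorial : ℝ) ≠ 0 := by positivity
      rw [h4]
      push_cast
      field_simp
      ring
  rw [le_div_iff₀ (by positivity)]
  nlinarith [mul_le_mul_of_nonneg_left f ht]

theorem summ_leRoy {α : ℝ} (hα : 0 < α) (x : ℝ) :
    Summable (fun n : ℕ => x ^ n / (n.factorial : ℝ) ^ α) := by
  rcases eq_or_ne x 0 with rfl | hx
  · exact summable_of_ne_finset_zero (s := {0}) (fun n hn => by simp at hn; simp [hn])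
  refine summable_of_ratio_test_tendsto_lt_one zero_lt_one
    (Eventually.of_forall fun n => by positivity) ?_
  have h : Tendsto (fun n : ℕ => |x| / ((n + 1 : ℕ) : ℝ) ^ α) atTop (𝓝 0) :=
    tendsto_const_nhds.div_atTop (((tendsto_rpow_atTop hα).comp
      tendsto_natCast_atTop_atTop).comp (tendsto_add_atTop_nat 1))
  refine h.congr fun n => ?_
  rw [Nat.factorial_succ, Nat.cast_mul, Real.mul_rpow (by positivity) (by positivity)]
  have h1 : (0 : ℝ) < ((n + 1 : ℕ) : ℝ) ^ α := by positivity
  have h2 : (0 : ℝ) < (n.factorial : ℝ) ^ α := by positivity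
  rw [norm_div, norm_div, norm_pow, norm_pow, norm_mul, Real.norm_of_nonneg h1.le,
    Real.norm_of_nonneg h2.le, Real.norm_eq_abs]
  have : |x| ≠ 0 := abs_ne_zero.2 hx
  field_simp
  ring

theorem egf_tendsto {α : ℝ} (hα : 0 < α) (hα1 : α ≤ 1) (t : ℝ) :
    Tendsto (fun N => egf (fun n => 1 * gaussP N n ^ (1 - α)) t) atTop (𝓝 (leRoy α (-t))) := by
  unfold egf leRoy
  have e : ∀ n : ℕ, ∀ y : ℝ, y / (n.factorial : ℝ) ^ α
      = 1 * (n.factorial : ℝ) ^ (1 - α) * y / (n.factorial : ℝ) := by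
    intro n y
    have h0 : (0 : ℝ) < n.factorial := by positivity
    rw [Real.rpow_sub h0, Real.rpow_one]
    have : (n.factorial : ℝ) ^ α ≠ 0 := by positivity
    field_simp
  refine tendsto_tsum_of_dominated_convergence (summ_leRoy hα |t|) ?_ ?_
  · intro n
    rw [e]
    refine Tendsto.div_const (Tendsto.mul_const _ (Tendsto.const_mul _ ?_)) _
    exact (gaussP_tendsto n).rpow_const (Or.inr (by linarith))
  · refine Eventually.of_forall fun N n => ?_
    have := (gaussP_pos N n).le
    rw [e, Real.norm_eq_abs, abs_div, abs_mul, abs_pow, abs_neg, Nat.abs_cast,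
      abs_of_nonneg (by positivity)]
    have h3 : gaussP N n ^ (1 - α) ≤ (n.factorial : ℝ) ^ (1 - α) :=
      Real.rpow_le_rpow this (gaussP_le N n) (by linarith)
    beta_reduce
    gcongr

theorem leRoy_exp_hyperbolic_bounds (α x : ℝ) (hα : α ∈ Set.Ioc (0 : ℝ) 1) :
    Real.exp x ≤ leRoy α x ∧ (x < 1 → leRoy α x ≤ 1 / (1 - x)) := by
  obtain ⟨h0, h1⟩ := hα
  rcases le_total 0 x with hx | hx
  · have hf : ∀ n : ℕ, (1 : ℝ) ≤ n.factorial := fun n => by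
      exact_mod_cast Nat.one_le_iff_ne_zero.2 n.factorial_ne_zero
    constructor
    · rw [Real.exp_eq_exp_ℝ, NormedSpace.exp_eq_tsum_div]
      refine Summable.tsum_le_tsum (fun n => ?_) (Real.summable_pow_div_factorial x)
        (summ_leRoy h0 x)
      have : (n.factorial : ℝ) ^ α ≤ n.factorial := by
        simpa using Real.rpow_le_rpow_of_exponent_le (hf n) h1
      gcongr
    · intro hx1
      rw [one_div, ← tsum_geometric_of_lt_one hx hx1]
      refine Summable.tsum_le_tsum (fun n => ?_) (summ_leRoy h0 x)
        (summable_geometric_of_lt_one hx hx1)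
      exact div_le_self (by positivity) (Real.one_le_rpow (hf n) h0.le)
  · obtain ⟨t, rfl⟩ : ∃ t, x = -t := ⟨-x, by simp⟩
    have ht : 0 ≤ t := by linarith
    have hT := egf_tendsto h0 h1 t
    constructor
    · refine ge_of_tendsto' hT fun N => ?_
      rw [← egf_one]
      exact (good_gauss good_one (by linarith) N).2 t ht
    · intro _
      rw [sub_neg_eq_add]
      refine le_of_tendsto' hT fun N => ?_
      obtain ⟨g, -⟩ := good_gauss good_one (s := 1 - α) (by linarith) N
      obtain ⟨g1, g2⟩ := good_gauss g h0.le N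
      have e : (fun n => 1 * gaussP N n ^ (1 - α) * gaussP N n ^ α) = gaussP N := by
        ext n
        rw [one_mul, ← Real.rpow_add (gaussP_pos N n)]
        simp
      rw [e] at g1 g2
      exact (g2 t ht).trans (egf_gauss_le N g1 ht)
end

section
/- Let α ∈ (0,1] and α < β ≤ β′. For every x > 0 one has Γ(β′) E_{α,β′}(x) ≤ Γ(β) E_{α,β}(x), and for every x < 0 one has Γ(β) E_{α,β}(x) ≤ Γ(β′) E_{α,β′}(x). -/
/-- The two-parameter Mittag-Leffler function `E_{α,β}(x)` for real argument. -/
noncomputable def mittagLeffler (α β : ℝ) (x : ℝ) : ℝ :=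
  ∑' n : ℕ, x ^ n / Real.Gamma (β + α * n)

open MeasureTheory Set

lemma beta_int {a b : ℝ} (ha : 0 < a) (hb : 0 < b) :
    IntegrableOn (fun u : ℝ => u ^ (a - 1) * (1 - u) ^ (b - 1)) (Ioo 0 1) ∧
    ∫ u in Ioo (0:ℝ) 1, u ^ (a - 1) * (1 - u) ^ (b - 1)
      = Real.Gamma a * Real.Gamma b / Real.Gamma (a + b) := by
  have h1 := Complex.betaIntegral_convergent (u := a) (v := b) (by simpa) (by simpa)
  rw [intervalIntegrable_iff_integrableOn_Ioo_of_le zero_le_one] at h1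
  have key : ∀ u ∈ Ioo (0:ℝ) 1, (u : ℂ) ^ ((a:ℂ) - 1) * (1 - (u : ℂ)) ^ ((b:ℂ) - 1)
      = ((u ^ (a - 1) * (1 - u) ^ (b - 1) : ℝ) : ℂ) := by
    intro u hu
    have h2 : 0 ≤ 1 - u := by linarith [hu.2]
    rw [Complex.ofReal_mul, Complex.ofReal_cpow hu.1.le, Complex.ofReal_cpow h2]
    push_cast
    rfl
  have h3 : IntegrableOn (fun u : ℝ => ((u ^ (a - 1) * (1 - u) ^ (b - 1) : ℝ) : ℂ)) (Ioo 0 1) :=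
    h1.congr_fun key measurableSet_Ioo
  have h4 : IntegrableOn (fun u : ℝ => u ^ (a - 1) * (1 - u) ^ (b - 1)) (Ioo 0 1) := by
    have h := h3.re
    simpa [IntegrableOn] using h
  refine ⟨h4, ?_⟩
  have h5 := ProbabilityTheory.beta_eq_betaIntegralReal a b ha hb
  rw [ProbabilityTheory.beta, Complex.betaIntegral, intervalIntegral.integral_of_le zero_le_one,
    integral_Ioc_eq_integral_Ioo, setIntegral_congr_fun measurableSet_Ioo key] at h5
  rw [h5, integral_complex_ofReal, Complex.ofReal_re]

lemma gamma_lower {z R : ℝ} (hz : 1 ≤ z) (hR : 0 < R) :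
    R ^ (z - 1) * Real.exp (-R) ≤ Real.Gamma z := by
  rw [Real.Gamma_eq_integral (by linarith)]
  have hI := Real.GammaIntegral_convergent (s := z) (by linarith)
  have hsub : Ioi R ⊆ Ioi 0 := Ioi_subset_Ioi hR.le
  calc R ^ (z - 1) * Real.exp (-R) = ∫ x in Ioi R, Real.exp (-x) * R ^ (z - 1) := by
        rw [integral_mul_const, integral_exp_neg_Ioi, mul_comm]
    _ ≤ ∫ x in Ioi R, Real.exp (-x) * x ^ (z - 1) := by
        refine setIntegral_mono_on ?_ (hI.mono_set hsub) measurableSet_Ioi ?_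
        · exact (integrableOn_exp_neg_Ioi R).mul_const _
        · intro x hx
          have : R ≤ x := le_of_lt hx
          have : R ^ (z - 1) ≤ x ^ (z - 1) := Real.rpow_le_rpow hR.le this (by linarith)
          gcongr
    _ ≤ _ := by
        refine setIntegral_mono_set hI ?_ hsub.eventuallyLE
        filter_upwards [ae_restrict_mem measurableSet_Ioi] with x hx
        have : (0:ℝ) < x := hx
        simp only [Pi.zero_apply]
        positivity

lemma ml_summable {α : ℝ} (hα : 0 < α) (b x : ℝ) :
    Summable (fun n : ℕ => x ^ n / Real.Gamma (b + α * n)) := by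
  set R : ℝ := (2 * |x| + 1) ^ (1 / α) with hRdef
  have hpos : 0 < 2 * |x| + 1 := by positivity
  have hR : 0 < R := by positivity
  have hRa : R ^ α = 2 * |x| + 1 := by
    rw [hRdef, ← Real.rpow_mul hpos.le, one_div, inv_mul_cancel₀ hα.ne', Real.rpow_one]
  have hg : Summable (fun n : ℕ => Real.exp R * R ^ (1 - b) * (1 / 2 : ℝ) ^ n) :=
    summable_geometric_two.mul_left _
  refine Summable.of_norm_bounded_eventually_nat hg ?_
  obtain ⟨N, hN⟩ := exists_nat_gt ((1 - b) / α)
  filter_upwards [Filter.eventually_ge_atTop N] with n hn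
  have hz : 1 ≤ b + α * n := by
    have : (N : ℝ) ≤ n := by exact_mod_cast hn
    have h : (1 - b) / α ≤ n := by linarith
    rw [div_le_iff₀ hα] at h
    linarith
  have hG := gamma_lower hz hR
  have hpw : R ^ (b + α * n - 1) = R ^ (b - 1) * (2 * |x| + 1) ^ n := by
    rw [← hRa, ← Real.rpow_natCast, ← Real.rpow_mul hR.le, ← Real.rpow_add hR]
    congr 1; ring
  have hlow : 0 < R ^ (b + α * n - 1) * Real.exp (-R) := by positivity
  rw [norm_div, norm_pow, Real.norm_eq_abs, Real.norm_eq_abs, abs_of_pos (hlow.trans_le hG)]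
  calc |x| ^ n / Real.Gamma (b + α * n) ≤ |x| ^ n / (R ^ (b + α * n - 1) * Real.exp (-R)) := by
        gcongr
    _ = Real.exp R * R ^ (1 - b) * (|x| / (2 * |x| + 1)) ^ n := by
        rw [hpw, Real.exp_neg, show (1 - b) = -(b - 1) by ring, Real.rpow_neg hR.le, div_pow]
        field_simp
    _ ≤ _ := by
        have : |x| / (2 * |x| + 1) ≤ 1 / 2 := by
          rw [div_le_div_iff₀ hpos two_pos]
          linarith [abs_nonneg x]
        have h0 : 0 ≤ |x| / (2 * |x| + 1) := by positivity
        have := pow_le_pow_left₀ h0 this n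
        gcongr

lemma ml_double_summable {α : ℝ} (hα : 0 < α) (c x y : ℝ) :
    Summable (fun p : ℕ × ℕ => x ^ p.1 * y ^ p.2 / Real.Gamma (c + α * (p.1 + p.2 : ℕ))) := by
  set R := max |x| |y| with hR
  have hs := (ml_summable hα c (2 * R)).norm
  set C := ∑' n : ℕ, ‖(2 * R) ^ n / Real.Gamma (c + α * n)‖ with hC
  have hle : ∀ n : ℕ, ‖(2 * R) ^ n / Real.Gamma (c + α * n)‖ ≤ C := fun n =>
    hs.le_tsum n (fun _ _ => norm_nonneg _)
  have hgeo : Summable (fun p : ℕ × ℕ => C * ((1 / 2 : ℝ) ^ p.1 * (1 / 2 : ℝ) ^ p.2)) :=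
    (summable_geometric_two.mul_of_nonneg summable_geometric_two
      (fun n => by positivity) (fun n => by positivity)).mul_left C
  refine Summable.of_norm_bounded hgeo ?_
  rintro ⟨m, n⟩
  have h1 := hle (m + n)
  have hR0 : 0 ≤ R := (abs_nonneg x).trans (le_max_left _ _)
  rw [norm_div, norm_pow, norm_mul, Real.norm_of_nonneg hR0] at h1
  rw [norm_div, norm_mul, norm_pow, norm_pow]
  have hx : ‖x‖ ^ m ≤ R ^ m := pow_le_pow_left₀ (norm_nonneg _) (le_max_left _ _) _
  have hy : ‖y‖ ^ n ≤ R ^ n := pow_le_pow_left₀ (norm_nonneg _) (le_max_right _ _) _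
  calc ‖x‖ ^ m * ‖y‖ ^ n / ‖Real.Gamma (c + α * (m + n : ℕ))‖
      ≤ R ^ m * R ^ n / ‖Real.Gamma (c + α * (m + n : ℕ))‖ := by gcongr
    _ = (‖(2 : ℝ)‖ * R) ^ (m + n) / ‖Real.Gamma (c + α * (m + n : ℕ))‖
          * ((1 / 2 : ℝ) ^ m * (1 / 2 : ℝ) ^ n) := by
        have h2 : (1 / 2 : ℝ) ^ m * (1 / 2 : ℝ) ^ n * 2 ^ (m + n) = 1 := by
          rw [← pow_add, ← mul_pow]; norm_num
        rw [Real.norm_of_nonneg (by norm_num : (0:ℝ) ≤ 2), mul_pow]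
        rw [← pow_add]
        linear_combination (-(R ^ (m + n) / ‖Real.Gamma (c + α * (m + n : ℕ))‖)) * h2
    _ ≤ _ := by gcongr

lemma tsum_antidiag {G : ℕ × ℕ → ℝ} (h : Summable G) :
    ∑' p, G p = ∑' N, ∑ kl ∈ Finset.HasAntidiagonal.antidiagonal N, G kl := by
  conv_rhs => congr; ext; rw [← Finset.sum_finset_coe, ← tsum_fintype (L := .unconditional _)]
  rw [← Finset.HasAntidiagonal.sigmaAntidiagonalEquivProd.tsum_eq G]
  exact (Finset.HasAntidiagonal.sigmaAntidiagonalEquivProd.summable_iff.mpr h).tsum_sigma'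
    (fun n ↦ (hasSum_fintype _).summable)

lemma ml_term {u a α : ℝ} (hu : 0 < u) (x : ℝ) (m : ℕ) :
    u ^ (a - 1) * ((x * u ^ α) ^ m / Real.Gamma (a + α * m))
      = x ^ m / Real.Gamma (a + α * m) * u ^ (a + α * m - 1) := by
  have : u ^ (a + α * m - 1) = u ^ (a - 1) * (u ^ α) ^ m := by
    rw [← Real.rpow_natCast, ← Real.rpow_mul hu.le, ← Real.rpow_add hu]
    congr 1; ring
  rw [this, mul_pow]; ring

lemma ml_conv {α a b : ℝ} (hα : 0 < α) (ha : 0 < a) (hb : 0 < b) (x y : ℝ) :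
    ∫ u in Ioo (0:ℝ) 1, (u ^ (a - 1) * mittagLeffler α a (x * u ^ α))
        * ((1 - u) ^ (b - 1) * mittagLeffler α b (y * (1 - u) ^ α))
      = ∑' N : ℕ, (∑ i ∈ Finset.range (N + 1), x ^ i * y ^ (N - i))
          / Real.Gamma (a + b + α * N) := by
  have hGa : ∀ m : ℕ, 0 < a + α * m := fun m => by positivity
  have hGb : ∀ m : ℕ, 0 < b + α * m := fun m => by positivity
  let F : ℕ × ℕ → ℝ → ℝ := fun p u =>
    x ^ p.1 / Real.Gamma (a + α * p.1) * (y ^ p.2 / Real.Gamma (b + α * p.2)) *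
      (u ^ (a + α * p.1 - 1) * (1 - u) ^ (b + α * p.2 - 1))
  have hFint : ∀ p, Integrable (F p) (volume.restrict (Ioo 0 1)) := fun p =>
    (beta_int (hGa p.1) (hGb p.2)).1.const_mul _
  have hval : ∀ (s t : ℝ) (p : ℕ × ℕ),
      s ^ p.1 / Real.Gamma (a + α * p.1) * (t ^ p.2 / Real.Gamma (b + α * p.2)) *
      ∫ u in Ioo (0:ℝ) 1, (u ^ (a + α * p.1 - 1) * (1 - u) ^ (b + α * p.2 - 1))
      = s ^ p.1 * t ^ p.2 / Real.Gamma (a + b + α * (p.1 + p.2 : ℕ)) := by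
    intro s t p
    rw [(beta_int (hGa p.1) (hGb p.2)).2]
    have h1 := (Real.Gamma_pos_of_pos (hGa p.1)).ne'
    have h2 := (Real.Gamma_pos_of_pos (hGb p.2)).ne'
    have h3 : a + α * p.1 + (b + α * p.2) = a + b + α * (p.1 + p.2 : ℕ) := by push_cast; ring
    rw [h3]
    field_simp
  have hFval : ∀ p, ∫ u in Ioo (0:ℝ) 1, F p u
      = x ^ p.1 * y ^ p.2 / Real.Gamma (a + b + α * (p.1 + p.2 : ℕ)) := by
    intro p
    rw [← hval, ← integral_const_mul]
  have hFnorm : ∀ p, ∫ u in Ioo (0:ℝ) 1, ‖F p u‖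
      = |x| ^ p.1 * |y| ^ p.2 / Real.Gamma (a + b + α * (p.1 + p.2 : ℕ)) := by
    intro p
    rw [← hval, ← integral_const_mul]
    refine setIntegral_congr_fun measurableSet_Ioo ?_
    intro u hu
    have h0 : 0 < u := hu.1
    have h1 : 0 < 1 - u := by linarith [hu.2]
    have h2 := (Real.Gamma_pos_of_pos (hGa p.1))
    have h3 := (Real.Gamma_pos_of_pos (hGb p.2))
    have h4 : 0 ≤ u ^ (a + α * p.1 - 1) * (1 - u) ^ (b + α * p.2 - 1) := by positivity
    simp only [F, norm_mul (_ * _) (_ * _), Real.norm_of_nonneg h4]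
    rw [norm_mul, norm_div, norm_div, norm_pow, norm_pow, Real.norm_of_nonneg h2.le,
      Real.norm_of_nonneg h3.le, Real.norm_eq_abs, Real.norm_eq_abs]
  have hsum := hasSum_integral_of_summable_integral_norm hFint (by
    simp_rw [hFnorm]
    exact ml_double_summable hα (a + b) |x| |y|)
  have hlhs : ∫ u in Ioo (0:ℝ) 1, (u ^ (a - 1) * mittagLeffler α a (x * u ^ α))
        * ((1 - u) ^ (b - 1) * mittagLeffler α b (y * (1 - u) ^ α))
      = ∫ u in Ioo (0:ℝ) 1, ∑' p, F p u := by
    refine setIntegral_congr_fun measurableSet_Ioo ?_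
    intro u hu
    have h0 : 0 < u := hu.1
    have h1 : 0 < 1 - u := by linarith [hu.2]
    simp only [mittagLeffler]
    rw [← tsum_mul_left, ← tsum_mul_left, tsum_mul_tsum_of_summable_norm
      ((ml_summable hα a _).mul_left _).norm ((ml_summable hα b _).mul_left _).norm]
    refine tsum_congr fun p => ?_
    rw [ml_term h0, ml_term h1]
    simp only [F]
    ring
  rw [hlhs, ← hsum.tsum_eq]
  simp_rw [hFval]
  rw [tsum_antidiag (ml_double_summable hα (a + b) x y)]
  refine tsum_congr fun N => ?_
  rw [Finset.Nat.sum_antidiagonal_eq_sum_range_succ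
    (fun i j => x ^ i * y ^ j / Real.Gamma (a + b + α * (i + j : ℕ))), Finset.sum_div]
  refine Finset.sum_congr rfl fun i hi => ?_
  rw [Nat.add_sub_cancel' (Nat.lt_succ_iff.mp (Finset.mem_range.mp hi))]

lemma ml_zero (α b : ℝ) : mittagLeffler α b 0 = 1 / Real.Gamma b := by
  rw [mittagLeffler, tsum_eq_single 0]
  · simp
  · intro n hn; simp [hn]

lemma ml_avg {α a b : ℝ} (hα : 0 < α) (ha : 0 < a) (hb : 0 < b) (x : ℝ) :
    ∫ u in Ioo (0:ℝ) 1, u ^ (a - 1) * (1 - u) ^ (b - 1) * mittagLeffler α a (x * u ^ α)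
      = Real.Gamma b * mittagLeffler α (a + b) x := by
  have h := ml_conv hα ha hb x 0
  have hG := (Real.Gamma_pos_of_pos hb).ne'
  have h2 : ∀ N : ℕ, ∑ i ∈ Finset.range (N + 1), x ^ i * (0:ℝ) ^ (N - i) = x ^ N := by
    intro N
    rw [Finset.sum_range_succ, Finset.sum_eq_zero]
    · simp
    · intro i hi
      have : N - i ≠ 0 := by have := Finset.mem_range.mp hi; omega
      simp [this]
  simp_rw [h2, zero_mul, ml_zero] at h
  rw [mittagLeffler, ← h, ← integral_const_mul]
  refine setIntegral_congr_fun measurableSet_Ioo fun u _ => ?_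
  field_simp

lemma ml_sub {α b : ℝ} (hα : 0 < α) (hb : 0 < b) (x y : ℝ) :
    mittagLeffler α b x - mittagLeffler α b y = (x - y) *
    ∫ u in Ioo (0:ℝ) 1, (u ^ (b - 1) * mittagLeffler α b (x * u ^ α))
        * ((1 - u) ^ (α - 1) * mittagLeffler α α (y * (1 - u) ^ α)) := by
  rw [ml_conv hα hb hα, ← tsum_mul_left, mittagLeffler, mittagLeffler,
    ← (ml_summable hα b x).tsum_sub (ml_summable hα b y),
    ((ml_summable hα b x).sub (ml_summable hα b y)).tsum_eq_zero_add]
  simp only [pow_zero, sub_self, zero_add]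
  refine tsum_congr fun N => ?_
  have h := (Commute.all x y).mul_geom_sum₂ (N + 1)
  simp only [Nat.add_sub_cancel] at h
  rw [← mul_div_assoc, h, sub_div]
  congr 3 <;> · push_cast; ring

lemma ml_continuous {α : ℝ} (hα : 0 < α) (b : ℝ) : Continuous (mittagLeffler α b) := by
  rw [continuous_iff_continuousAt]
  intro x
  have h : ContinuousOn (mittagLeffler α b) (Icc (-(|x| + 1)) (|x| + 1)) := by
    unfold mittagLeffler
    refine continuousOn_tsum (fun n => by fun_prop) (ml_summable hα b (|x| + 1)).norm ?_
    intro n y hy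
    rw [norm_div, norm_div, norm_pow, norm_pow]
    have h1 : ‖y‖ ≤ ‖|x| + 1‖ := by
      rw [Real.norm_of_nonneg (by positivity : 0 ≤ |x| + 1)]
      exact abs_le.mpr hy
    gcongr
  refine h.continuousAt (Icc_mem_nhds ?_ ?_)
  · linarith [neg_abs_le x]
  · linarith [le_abs_self x]

lemma beta_ii {a b : ℝ} (ha : 0 < a) (hb : 0 < b) {h : ℝ → ℝ} (hc : Continuous h) :
    IntervalIntegrable (fun u : ℝ => u ^ (a - 1) * (1 - u) ^ (b - 1) * h u) volume 0 1 := by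
  refine IntervalIntegrable.mul_continuousOn ?_ hc.continuousOn
  rw [intervalIntegrable_iff_integrableOn_Ioo_of_le zero_le_one]
  exact (beta_int ha hb).1

lemma ml_rpow_cont {α : ℝ} (hα : 0 < α) (b x : ℝ) :
    Continuous (fun u : ℝ => mittagLeffler α b (x * u ^ α)) :=
  (ml_continuous hα b).comp (continuous_const.mul (Real.continuous_rpow_const hα.le))

lemma ml_avg' {α a b : ℝ} (hα : 0 < α) (ha : 0 < a) (hb : 0 < b) (x : ℝ) :
    ∫ u in (0:ℝ)..1, u ^ (a - 1) * (1 - u) ^ (b - 1) * mittagLeffler α a (x * u ^ α)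
      = Real.Gamma b * mittagLeffler α (a + b) x := by
  rw [← ml_avg hα ha hb, intervalIntegral.integral_of_le zero_le_one, integral_Ioc_eq_integral_Ioo]

lemma ml_volterra {α : ℝ} (hα : 0 < α) (x : ℝ) :
    Real.Gamma α * mittagLeffler α α x = 1 + x *
      ∫ u in (0:ℝ)..1, u ^ (α - 1) * (1 - u) ^ (α - 1) * mittagLeffler α α (x * u ^ α) := by
  rw [ml_avg' hα hα hα]
  have hG := (Real.Gamma_pos_of_pos hα).ne'
  have h : mittagLeffler α α x = 1 / Real.Gamma α + x * mittagLeffler α (α + α) x := by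
    conv_lhs => rw [mittagLeffler, (ml_summable hα α x).tsum_eq_zero_add]
    rw [mittagLeffler, ← tsum_mul_left]
    congr 1
    · simp
    · refine tsum_congr fun n => ?_
      rw [pow_succ', mul_div_assoc]
      congr 3
      push_cast; ring
  rw [h]
  field_simp

lemma ml_pos {α : ℝ} (hα : 0 < α) (hα1 : α ≤ 1) {x : ℝ} (hx : x ≤ 0) :
    0 < mittagLeffler α α x := by
  by_contra hneg
  have hG := Real.Gamma_pos_of_pos hα
  set Z : Set ℝ := {y | 0 ≤ y ∧ mittagLeffler α α (-y) ≤ 0} with hZ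
  have hZne : Z.Nonempty := ⟨-x, by linarith, by rw [neg_neg]; exact not_lt.mp hneg⟩
  have hZc : IsClosed Z := by
    refine IsClosed.and ?_ ?_
    · exact isClosed_le continuous_const continuous_id
    · exact isClosed_le ((ml_continuous hα α).comp continuous_neg) continuous_const
  have hZb : BddBelow Z := ⟨0, fun y hy => hy.1⟩
  obtain ⟨hT0, hT1⟩ : sInf Z ∈ Z := hZc.csInf_mem hZne hZb
  have hlt : ∀ y, 0 ≤ y → y < sInf Z → 0 < mittagLeffler α α (-y) := by
    intro y hy0 hy
    by_contra hc
    exact absurd (csInf_le hZb (show y ∈ Z from ⟨hy0, not_lt.mp hc⟩)) (not_le.mpr hy)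
  set T := sInf Z with hTdef
  have hTpos : 0 < T := by
    rcases hT0.lt_or_eq with h | h
    · exact h
    · rw [← h, neg_zero, ml_zero] at hT1
      have : 0 < 1 / Real.Gamma α := by positivity
      linarith
  set h : ℝ → ℝ := fun u => mittagLeffler α α (-T * u ^ α) with hh
  have hcont : Continuous h := ml_rpow_cont hα α (-T)
  have hpos : ∀ u, 0 ≤ u → u < 1 → 0 < h u := by
    intro u hu0 hu1
    have h1 : u ^ α < 1 := Real.rpow_lt_one hu0 hu1 hα
    have h0 : 0 ≤ u ^ α := Real.rpow_nonneg hu0 _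
    have := hlt (T * u ^ α) (by positivity) (by nlinarith)
    simpa [hh, neg_mul] using this
  have h1le : h 1 ≤ 0 := by simpa [hh] using hT1
  have hge : ∀ u, 0 ≤ u → u ≤ 1 → u < 1 → 0 ≤ h u := fun u a _ b => (hpos u a b).le
  set k : ℝ → ℝ := fun u => u ^ (α - 1) * (1 - u) ^ (α - 1) with hk
  have hkint : IntervalIntegrable k volume 0 1 := by
    simpa using beta_ii hα hα (h := fun _ => 1) continuous_const
  -- choose t1 close to 1
  obtain ⟨t1, ht1, hsmall⟩ : ∃ t1 ∈ Ioo (0:ℝ) 1, T * ∫ u in t1..1, k u < Real.Gamma α := by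
    have hP : ContinuousOn (fun t => ∫ u in (0:ℝ)..t, k u) (uIcc 0 1) :=
      intervalIntegral.continuousOn_primitive_interval' hkint left_mem_uIcc
    rw [uIcc_of_le zero_le_one] at hP
    have hP1 : ContinuousWithinAt (fun t => ∫ u in (0:ℝ)..t, k u) (Ioo 0 1) 1 :=
      (hP 1 (by simp)).mono Ioo_subset_Icc_self
    have hlim : Filter.Tendsto (fun t => T * ((∫ u in (0:ℝ)..1, k u) - ∫ u in (0:ℝ)..t, k u))
        (nhdsWithin 1 (Ioo 0 1)) (nhds 0) := by
      have := (hP1.tendsto.const_sub (∫ u in (0:ℝ)..1, k u)).const_mul T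
      simpa using this
    have hev := hlim.eventually (gt_mem_nhds hG)
    have hne : (nhdsWithin (1:ℝ) (Ioo 0 1)).NeBot := by
      rw [← mem_closure_iff_nhdsWithin_neBot, closure_Ioo (by norm_num)]
      simp
    obtain ⟨t, ht, htm⟩ := (hev.and self_mem_nhdsWithin).exists
    refine ⟨t, htm, ?_⟩
    have hsub : IntervalIntegrable k volume 0 t :=
      hkint.mono_set (by
        rw [uIcc_of_le htm.1.le, uIcc_of_le zero_le_one]
        exact Icc_subset_Icc_right htm.2.le)
    rw [intervalIntegral.integral_interval_sub_left hkint hsub] at ht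
    exact ht
  -- the maximiser
  obtain ⟨t, htI, htmax⟩ := (isCompact_Icc (a := t1) (b := (1:ℝ))).exists_isMaxOn
    ⟨1, right_mem_Icc.mpr ht1.2.le⟩ hcont.continuousOn
  have htmax' : ∀ u ∈ Icc t1 1, h u ≤ h t := fun u hu => htmax hu
  have ht0 : 0 < t := ht1.1.trans_le htI.1
  have htlt : t < 1 := by
    rcases htI.2.lt_or_eq with h' | h'
    · exact h'
    · have a1 := htmax' t1 (left_mem_Icc.mpr ht1.2.le)
      have a2 := hpos t1 ht1.1.le ht1.2
      rw [h'] at a1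
      linarith
  have hgint : IntervalIntegrable (fun u => k u * h u) volume 0 1 := beta_ii hα hα hcont
  have hsub0 : ∀ {f : ℝ → ℝ} {s : ℝ}, s ∈ Icc (0:ℝ) 1 → IntervalIntegrable f volume 0 1 →
      IntervalIntegrable f volume 0 s ∧ IntervalIntegrable f volume s 1 := by
    intro f s hs hf
    constructor
    · refine hf.mono_set ?_
      rw [uIcc_of_le hs.1, uIcc_of_le zero_le_one]
      exact Icc_subset_Icc_right hs.2
    · refine hf.mono_set ?_
      rw [uIcc_of_le hs.2, uIcc_of_le zero_le_one]
      exact Icc_subset_Icc_left hs.1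
  have htmem : t ∈ Icc (0:ℝ) 1 := ⟨ht0.le, htlt.le⟩
  have hsplit := intervalIntegral.integral_add_adjacent_intervals
    (hsub0 htmem hgint).1 (hsub0 htmem hgint).2
  have hV1 := ml_volterra hα (-T)
  have hVt := ml_volterra hα (-T * t ^ α)
  have hkpos : ∀ u ∈ Ioo (0:ℝ) 1, 0 ≤ k u := by
    intro u hu
    have h0 : 0 < u := hu.1
    have h1 : 0 < 1 - u := by linarith [hu.2]
    simp only [hk]; positivity
  -- second piece
  have hB : ∫ u in t..1, k u * h u ≤ h t * ∫ u in t..1, k u := by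
    rw [← intervalIntegral.integral_const_mul]
    refine intervalIntegral.integral_mono_on_of_le_Ioo htlt.le (hsub0 htmem hgint).2
      ((hsub0 htmem hkint).2.const_mul _) ?_
    intro u hu
    have := htmax' u ⟨htI.1.trans hu.1.le, hu.2.le⟩
    have hk0 := hkpos u ⟨ht0.trans hu.1, hu.2⟩
    nlinarith
  have hB' : ∫ u in t..1, k u ≤ ∫ u in t1..1, k u := by
    have ht1m : t1 ∈ Icc (0:ℝ) 1 := ⟨ht1.1.le, ht1.2.le⟩
    have i1 := (hsub0 ht1m hkint).2
    have i2 : IntervalIntegrable k volume t1 t := i1.mono_set (by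
      rw [uIcc_of_le htI.1, uIcc_of_le ht1.2.le]
      exact Icc_subset_Icc_right htlt.le)
    have := intervalIntegral.integral_add_adjacent_intervals i2 (hsub0 htmem hkint).2
    have nn : 0 ≤ ∫ u in t1..t, k u := by
      refine intervalIntegral.integral_nonneg htI.1 ?_
      intro u hu
      exact hkpos u ⟨ht1.1.trans_le hu.1, hu.2.trans_lt htlt⟩
    linarith
  -- first piece
  set J := ∫ u in (0:ℝ)..1, u ^ (α - 1) * (1 - u) ^ (α - 1)
    * mittagLeffler α α (-T * t ^ α * u ^ α) with hJ
  have hA : ∫ u in (0:ℝ)..t, k u * h u ≤ t ^ α * J := by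
    have hsubst := intervalIntegral.mul_integral_comp_mul_left (a := 0) (b := 1)
      (f := fun u => k u * h u) t
    rw [mul_zero, mul_one] at hsubst
    have hii : IntervalIntegrable (fun u => k (t * u) * h (t * u)) volume 0 1 := by
      have := (hsub0 htmem hgint).1.comp_mul_left (c := t)
      simpa [ht0.ne'] using this
    rw [← hsubst, hJ, ← intervalIntegral.integral_const_mul, ← intervalIntegral.integral_const_mul]
    refine intervalIntegral.integral_mono_on_of_le_Ioo zero_le_one (hii.const_mul _)
      ((beta_ii hα hα (ml_rpow_cont hα α (-T * t ^ α))).const_mul _) ?_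
    intro u hu
    have hu0 : 0 < u := hu.1
    have hu1 : 0 < 1 - u := by linarith [hu.2]
    have hm : h (t * u) = mittagLeffler α α (-T * t ^ α * u ^ α) := by
      simp only [hh]
      rw [Real.mul_rpow ht0.le hu0.le, mul_assoc]
    have hmp : 0 ≤ h (t * u) := (hpos _ (by positivity) (by nlinarith)).le
    rw [← hm]
    have hk1 : (1 - t * u) ^ (α - 1) ≤ (1 - u) ^ (α - 1) :=
      Real.rpow_le_rpow_of_nonpos hu1 (by nlinarith) (by linarith)
    have ht' : t * t ^ (α - 1) = t ^ α := by
      rw [Real.rpow_sub_one ht0.ne']; field_simp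
    simp only [hk]
    rw [Real.mul_rpow ht0.le hu0.le]
    calc t * (t ^ (α - 1) * u ^ (α - 1) * (1 - t * u) ^ (α - 1) * h (t * u))
        = t ^ α * (u ^ (α - 1) * (1 - t * u) ^ (α - 1) * h (t * u)) := by rw [← ht']; ring
      _ ≤ _ := by gcongr
  have e1 : mittagLeffler α α (-T * t ^ α) = h t := rfl
  rw [e1] at hVt
  have hVt' : Real.Gamma α * h t = 1 - T * (t ^ α * J) := by rw [hVt]; ring
  have hV1' : 1 ≤ T * ∫ u in (0:ℝ)..1, k u * h u := by
    have : Real.Gamma α * mittagLeffler α α (-T) ≤ 0 :=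
      mul_nonpos_of_nonneg_of_nonpos hG.le hT1
    have e2 : ∫ u in (0:ℝ)..1, u ^ (α - 1) * (1 - u) ^ (α - 1) * mittagLeffler α α (-T * u ^ α)
      = ∫ u in (0:ℝ)..1, k u * h u := rfl
    rw [e2] at hV1
    linarith
  have hht := hpos t ht0.le htlt
  have f1 : T * ∫ u in (0:ℝ)..t, k u * h u ≤ T * (t ^ α * J) := by gcongr
  have f2 : T * ∫ u in t..1, k u * h u ≤ T * (h t * ∫ u in t..1, k u) := by gcongr
  have f3 : h t * (T * ∫ u in t..1, k u) ≤ h t * (T * ∫ u in t1..1, k u) := by gcongr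
  have f4 : h t * (T * ∫ u in t1..1, k u) < h t * Real.Gamma α := by gcongr
  rw [← hsplit] at hV1'
  linarith

lemma ml_nonneg {α b : ℝ} (hα : 0 < α) (hα1 : α ≤ 1) (hb : α < b) {x : ℝ} (hx : x ≤ 0) :
    0 ≤ mittagLeffler α b x := by
  have h := ml_avg hα hα (sub_pos.mpr hb) x
  rw [add_sub_cancel] at h
  have hG := Real.Gamma_pos_of_pos (sub_pos.mpr hb)
  refine nonneg_of_mul_nonneg_right (a := Real.Gamma (b - α)) ?_ hG
  rw [← h]
  refine setIntegral_nonneg measurableSet_Ioo fun u hu => ?_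
  have h0 : 0 < u := hu.1
  have h1 : 0 < 1 - u := by linarith [hu.2]
  have h2 : x * u ^ α ≤ 0 := mul_nonpos_of_nonpos_of_nonneg hx (by positivity)
  have := ml_pos hα hα1 h2
  positivity

lemma ml_mono_neg {α b : ℝ} (hα : 0 < α) (hα1 : α ≤ 1) (hb : α < b) {x y : ℝ}
    (hx : x ≤ 0) (hyx : y ≤ x) : mittagLeffler α b y ≤ mittagLeffler α b x := by
  rw [← sub_nonneg, ml_sub hα (hα.trans hb)]
  refine mul_nonneg (sub_nonneg.mpr hyx) ?_
  refine setIntegral_nonneg measurableSet_Ioo fun u hu => ?_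
  have h0 : 0 < u := hu.1
  have h1 : 0 < 1 - u := by linarith [hu.2]
  have h2 : x * u ^ α ≤ 0 := mul_nonpos_of_nonpos_of_nonneg hx (by positivity)
  have h3 : y * (1 - u) ^ α ≤ 0 :=
    mul_nonpos_of_nonpos_of_nonneg (hyx.trans hx) (by positivity)
  have := ml_pos hα hα1 h3
  have := ml_nonneg hα hα1 hb h2
  positivity

lemma ml_mono_pos {α b : ℝ} (hα : 0 < α) (hb : 0 < b) {x y : ℝ}
    (hy : 0 ≤ y) (hyx : y ≤ x) : mittagLeffler α b y ≤ mittagLeffler α b x := by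
  refine (ml_summable hα b y).tsum_le_tsum (fun n => ?_) (ml_summable hα b x)
  have := Real.Gamma_pos_of_pos (show 0 < b + α * n by positivity)
  gcongr

theorem mittagLeffler_monotone_in_beta (α β β' x : ℝ)
    (hα : α ∈ Set.Ioc (0 : ℝ) 1) (hβ : α < β) (hββ' : β ≤ β') :
    (0 < x → Real.Gamma β' * mittagLeffler α β' x ≤ Real.Gamma β * mittagLeffler α β x) ∧
    (x < 0 → Real.Gamma β * mittagLeffler α β x ≤ Real.Gamma β' * mittagLeffler α β' x) := by
  rcases hββ'.eq_or_lt with rfl | hlt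
  · exact ⟨fun _ => le_rfl, fun _ => le_rfl⟩
  obtain ⟨hα0, hα1⟩ := hα
  have hb0 : 0 < β := hα0.trans hβ
  have hd : 0 < β' - β := sub_pos.mpr hlt
  have havg := ml_avg' hα0 hb0 hd x
  have hbeta : ∫ u in (0:ℝ)..1, u ^ (β - 1) * (1 - u) ^ (β' - β - 1) * mittagLeffler α β x
      = Real.Gamma β * Real.Gamma (β' - β) / Real.Gamma β' * mittagLeffler α β x := by
    rw [intervalIntegral.integral_mul_const, intervalIntegral.integral_of_le zero_le_one,
      integral_Ioc_eq_integral_Ioo, (beta_int hb0 hd).2, add_sub_cancel]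
  rw [add_sub_cancel] at havg
  have hG1 := Real.Gamma_pos_of_pos hd
  have hG2 := Real.Gamma_pos_of_pos (hb0.trans hlt)
  have i1 := beta_ii hb0 hd (ml_rpow_cont hα0 β x)
  have i2 := beta_ii hb0 hd (h := fun _ => mittagLeffler α β x) continuous_const
  constructor
  · intro hx
    have hle := intervalIntegral.integral_mono_on_of_le_Ioo zero_le_one i1 i2 (by
      intro u hu
      have h0 : 0 < u := hu.1
      have h1 : 0 < 1 - u := by linarith [hu.2]
      have h2 : u ^ α ≤ 1 := Real.rpow_le_one h0.le hu.2.le hα0.le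
      have := ml_mono_pos hα0 hb0 (show 0 ≤ x * u ^ α by positivity)
        (show x * u ^ α ≤ x by nlinarith)
      gcongr)
    rw [havg, hbeta] at hle
    refine le_of_mul_le_mul_left ?_ hG1
    have := mul_le_mul_of_nonneg_left hle hG2.le
    calc _ = _ := by ring
      _ ≤ _ := this
      _ = _ := by field_simp
  · intro hx
    have hle := intervalIntegral.integral_mono_on_of_le_Ioo zero_le_one i2 i1 (by
      intro u hu
      have h0 : 0 < u := hu.1
      have h1 : 0 < 1 - u := by linarith [hu.2]
      have h2 : u ^ α ≤ 1 := Real.rpow_le_one h0.le hu.2.le hα0.le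
      have h3 : 0 < u ^ α := by positivity
      have := ml_mono_neg hα0 hα1 hβ (show x * u ^ α ≤ 0 by nlinarith)
        (show x ≤ x * u ^ α by nlinarith)
      gcongr)
    rw [havg, hbeta] at hle
    refine le_of_mul_le_mul_left ?_ hG1
    have := mul_le_mul_of_nonneg_left hle hG2.le
    calc _ = _ := by field_simp
      _ ≤ _ := this
      _ = _ := by ring
end

section
/- Let a, b, c, d > 0 be real numbers with b + d ≤ a + c and min(b,d) ≤ min(a,c). Then for every z ∈ (0,1), one has z^b + z^d − z^a − z^c ≥ 0. -/
theorem rpow_aux (a b c d z : ℝ) (hz0 : 0 < z) (hz1 : z < 1)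
    (hsum : b + d ≤ a + c) (h1 : b ≤ a) (h2 : b ≤ c) :
    0 ≤ z ^ b + z ^ d - z ^ a - z ^ c := by
  have e1 : z ^ a = z ^ b * z ^ (a - b) := by
    rw [← Real.rpow_add hz0]; congr 1; ring
  have e2 : z ^ c = z ^ b * z ^ (c - b) := by
    rw [← Real.rpow_add hz0]; congr 1; ring
  have e3 : z ^ b * z ^ (a - b) * z ^ (c - b) ≤ z ^ d := by
    rw [← Real.rpow_add hz0, ← Real.rpow_add hz0]
    exact Real.rpow_le_rpow_of_exponent_ge hz0 hz1.le (by linarith)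
  have l1 : z ^ (a - b) ≤ 1 := Real.rpow_le_one hz0.le hz1.le (by linarith)
  have l2 : z ^ (c - b) ≤ 1 := Real.rpow_le_one hz0.le hz1.le (by linarith)
  have p := mul_nonneg (Real.rpow_pos_of_pos hz0 b).le
    (mul_nonneg (sub_nonneg.2 l1) (sub_nonneg.2 l2))
  rw [e1, e2]
  linarith

theorem rpow_convexity_inequality (a b c d z : ℝ)
    (ha : 0 < a) (hb : 0 < b) (hc : 0 < c) (hd : 0 < d)
    (hsum : b + d ≤ a + c) (hmin : min b d ≤ min a c) (hz : z ∈ Set.Ioo (0 : ℝ) 1) :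
    0 ≤ z ^ b + z ^ d - z ^ a - z ^ c := by
  obtain ⟨hz0, hz1⟩ := hz
  obtain ⟨h1, h2⟩ := le_min_iff.1 hmin
  rcases le_total b d with h | h
  · rw [min_eq_left h] at h1 h2
    exact rpow_aux a b c d z hz0 hz1 hsum h1 h2
  · rw [min_eq_right h] at h1 h2
    have := rpow_aux a d c b z hz0 hz1 (by linarith) h1 h2
    linarith
end

section
/- Let a, b > 0 and c ≥ b. For every convex function φ : ℝ → ℝ, one has (1/B(a,b)) ∫₀¹ φ((a+b)t) t^{a−1}(1−t)^{b−1} dt ≤ (1/B(a,c)) ∫₀¹ φ((a+c)t) t^{a−1}(1−t)^{c−1} dt; that is, a Beta(a,c)-distributed random variable scaled by (a+c) dominates a Beta(a,b)-distributed random variable scaled by (a+b) in the convex order. -/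
open MeasureTheory

/-- The Euler Beta function `B(a,b) = Γ(a)Γ(b)/Γ(a+b)`. -/
noncomputable def betaFn (a b : ℝ) : ℝ :=
  Real.Gamma a * Real.Gamma b / Real.Gamma (a + b)

open MeasureTheory ProbabilityTheory

namespace ScaledBeta

lemma key (a b d y z : ℝ) (ha : 0 < a) (hb : 0 < b) (hd : 0 < d) :
    betaPDFReal (a + b) d y * y⁻¹ * betaPDFReal a b (z / y)
      = (1 - z)⁻¹ * betaPDFReal a (b + d) z * betaPDFReal b d ((y - z) / (1 - z)) := by
  by_cases h : 0 < z ∧ z < y ∧ y < 1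
  · obtain ⟨hz, hzy, hy1⟩ := h
    have hy : 0 < y := hz.trans hzy
    have hz1 : 0 < 1 - z := by linarith
    have hyz : 0 < y - z := by linarith
    have h1y : 0 < 1 - y := by linarith
    have e1 : 1 - z / y = (y - z) / y := by field_simp
    have e2 : 1 - (y - z) / (1 - z) = (1 - y) / (1 - z) := by field_simp; ring
    have c1 : 0 < z / y ∧ z / y < 1 := ⟨by positivity, (div_lt_one hy).2 hzy⟩
    have c2 : 0 < (y - z) / (1 - z) ∧ (y - z) / (1 - z) < 1 :=
      ⟨by positivity, (div_lt_one hz1).2 (by linarith)⟩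
    rw [betaPDFReal, betaPDFReal, betaPDFReal, betaPDFReal, if_pos ⟨hy, hy1⟩, if_pos c1,
      if_pos ⟨hz, by linarith⟩, if_pos c2, e1, e2, Real.div_rpow hz.le hy.le,
      Real.div_rpow hyz.le hy.le, Real.div_rpow hyz.le hz1.le, Real.div_rpow h1y.le hz1.le]
    have p1 : y ^ (a + b - 1) = y ^ (a - 1) * y ^ (b - 1) * y := by
      rw [← Real.rpow_add hy, ← Real.rpow_add_one hy.ne']; congr 1; ring
    have p2 : (1 - z) ^ (b + d - 1) = (1 - z) ^ (b - 1) * (1 - z) ^ (d - 1) * (1 - z) := by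
      rw [← Real.rpow_add hz1, ← Real.rpow_add_one hz1.ne']; congr 1; ring
    rw [p1, p2]
    have q1 := (Real.rpow_pos_of_pos hy (a - 1)).ne'
    have q2 := (Real.rpow_pos_of_pos hy (b - 1)).ne'
    have q3 := (Real.rpow_pos_of_pos hz1 (b - 1)).ne'
    have q4 := (Real.rpow_pos_of_pos hz1 (d - 1)).ne'
    have g1 := (Real.Gamma_pos_of_pos ha).ne'
    have g2 := (Real.Gamma_pos_of_pos hb).ne'
    have g3 := (Real.Gamma_pos_of_pos hd).ne'
    have g4 := (Real.Gamma_pos_of_pos (add_pos ha hb)).ne'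
    have g5 := (Real.Gamma_pos_of_pos (add_pos hb hd)).ne'
    have g6 := (Real.Gamma_pos_of_pos (add_pos (add_pos ha hb) hd)).ne'
    simp only [beta, ← add_assoc]
    field_simp
  · have L : betaPDFReal (a + b) d y * y⁻¹ * betaPDFReal a b (z / y) = 0 := by
      by_cases hy : 0 < y ∧ y < 1
      · have : ¬ (0 < z / y ∧ z / y < 1) := by
          rintro ⟨h1, h2⟩
          have h3 := (div_lt_one hy.1).1 h2
          have h4 := (div_pos_iff_of_pos_right hy.1).1 h1
          exact h ⟨h4, h3, hy.2⟩
        simp [betaPDFReal, this]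
      · simp [betaPDFReal, hy]
    have R : betaPDFReal a (b + d) z * betaPDFReal b d ((y - z) / (1 - z)) = 0 := by
      by_cases hz : 0 < z ∧ z < 1
      · have hz1 : 0 < 1 - z := by linarith
        have : ¬ (0 < (y - z) / (1 - z) ∧ (y - z) / (1 - z) < 1) := by
          rintro ⟨h1, h2⟩
          have h3 := (div_lt_one hz1).1 h2
          have h4 := (div_pos_iff_of_pos_right hz1).1 h1
          exact h ⟨hz.1, by linarith, by linarith⟩
        simp [betaPDFReal, this]
      · simp [betaPDFReal, hz]
    rw [L, mul_assoc, R, mul_zero]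

lemma nonneg {a b : ℝ} (ha : 0 < a) (hb : 0 < b) (x : ℝ) : 0 ≤ betaPDFReal a b x := by
  by_cases h : 0 < x ∧ x < 1
  · exact (betaPDFReal_pos h.1 h.2 ha hb).le
  · simp [betaPDFReal, h]

lemma meas (a b : ℝ) : Measurable (betaPDF a b) :=
  (measurable_betaPDFReal a b).ennreal_ofReal

lemma scale (g : ℝ → ENNReal) (hg : Measurable g) {y : ℝ} (hy : 0 < y) :
    ∫⁻ x, g (y * x) = ENNReal.ofReal y⁻¹ * ∫⁻ x, g x := by
  rw [← lintegral_map (f := g) (g := fun x => y * x) hg (by fun_prop),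
    Real.map_volume_mul_left hy.ne', lintegral_smul_measure, abs_of_pos (inv_pos.2 hy),
    smul_eq_mul]

lemma affine (g : ℝ → ENNReal) (hg : Measurable g) {z : ℝ} (hz : z < 1) :
    ∫⁻ y, g ((y - z) / (1 - z)) = ENNReal.ofReal (1 - z) * ∫⁻ x, g x := by
  have h1 : 0 < 1 - z := by linarith
  have := lintegral_sub_right_eq_self (μ := (volume : Measure ℝ)) (fun y => g (y / (1 - z))) z
  rw [this]
  have h2 := scale g hg (inv_pos.2 h1)
  rw [inv_inv] at h2
  rw [← h2]
  simp only [div_eq_inv_mul]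

lemma conv (a b d : ℝ) (ha : 0 < a) (hb : 0 < b) (hd : 0 < d) (h : ℝ → ENNReal)
    (hh : Measurable h) :
    ∫⁻ y, ∫⁻ x, h (y * x) ∂(betaMeasure a b) ∂(betaMeasure (a + b) d)
      = ∫⁻ z, h z ∂(betaMeasure a (b + d)) := by
  have m1 := meas a b
  have m2 := meas (a + b) d
  have m3 := meas a (b + d)
  have m4 := meas b d
  have S : ∀ y, 0 < y → ∫⁻ x, h (y * x) ∂(betaMeasure a b)
      = ∫⁻ z, ENNReal.ofReal y⁻¹ * (betaPDF a b (z / y) * h z) := by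
    intro y hy
    rw [betaMeasure, lintegral_withDensity_eq_lintegral_mul _ m1 (by fun_prop),
      lintegral_const_mul _ (by fun_prop),
      ← scale (fun z => betaPDF a b (z / y) * h z) (by fun_prop) hy]
    simp [mul_div_cancel_left₀ _ hy.ne']
  have inner : Measurable fun y => ∫⁻ x, h (y * x) ∂(betaMeasure a b) := by
    have := isProbabilityMeasureBeta ha hb
    exact Measurable.lintegral_prod_right' (f := fun p : ℝ × ℝ => h (p.1 * p.2)) (by fun_prop)
  have E1 : ∫⁻ y, ∫⁻ x, h (y * x) ∂(betaMeasure a b) ∂(betaMeasure (a + b) d)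
      = ∫⁻ y, ∫⁻ z, ENNReal.ofReal (1 - z)⁻¹ *
          (betaPDF a (b + d) z * h z * betaPDF b d ((y - z) / (1 - z))) := by
    rw [betaMeasure, lintegral_withDensity_eq_lintegral_mul _ m2 inner]
    refine lintegral_congr fun y => ?_
    have K : ∀ z, betaPDF (a + b) d y * (ENNReal.ofReal y⁻¹ * (betaPDF a b (z / y) * h z))
        = ENNReal.ofReal (1 - z)⁻¹ *
          (betaPDF a (b + d) z * h z * betaPDF b d ((y - z) / (1 - z))) := by
      intro z
      have k := congrArg ENNReal.ofReal (key a b d y z ha hb hd)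
      rw [ENNReal.ofReal_mul' (nonneg ha hb _), ENNReal.ofReal_mul (nonneg (by positivity) hd _),
        ENNReal.ofReal_mul' (nonneg hb hd _),
        ENNReal.ofReal_mul' (nonneg ha (by positivity) _)] at k
      calc _ = (betaPDF (a + b) d y * ENNReal.ofReal y⁻¹ * betaPDF a b (z / y)) * h z := by ring
        _ = (ENNReal.ofReal (1 - z)⁻¹ * betaPDF a (b + d) z * betaPDF b d ((y - z) / (1 - z)))
            * h z := by rw [betaPDF, betaPDF, k]; rfl
        _ = _ := by ring
    rw [← lintegral_congr K, lintegral_const_mul _ (by fun_prop), Pi.mul_apply]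
    by_cases hy : 0 < y
    · rw [S y hy]
    · rw [betaPDF_eq_zero_of_nonpos (not_lt.1 hy), zero_mul, zero_mul]
  rw [E1, lintegral_lintegral_swap (by fun_prop), betaMeasure,
    lintegral_withDensity_eq_lintegral_mul _ m3 hh]
  refine lintegral_congr fun z => ?_
  rw [lintegral_const_mul _ (by fun_prop), lintegral_const_mul _ (by fun_prop), Pi.mul_apply]
  by_cases hz : z < 1
  · rw [affine _ m4 hz, lintegral_betaPDF_eq_one hb hd, mul_one, mul_comm, mul_assoc,
      ← ENNReal.ofReal_mul (by linarith), mul_inv_cancel₀ (by linarith), ENNReal.ofReal_one,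
      mul_one]
  · rw [betaPDF_eq_zero_of_one_le (not_lt.1 hz)]; simp

lemma map_eq (a b d : ℝ) (ha : 0 < a) (hb : 0 < b) (hd : 0 < d) :
    ((betaMeasure a b).prod (betaMeasure (a + b) d)).map (fun p => p.2 * p.1)
      = betaMeasure a (b + d) := by
  have := isProbabilityMeasureBeta ha hb
  have := isProbabilityMeasureBeta (add_pos ha hb) hd
  refine Measure.ext_of_lintegral _ fun f hf => ?_
  rw [lintegral_map hf (by fun_prop), lintegral_prod_symm _ (by fun_prop), ← conv a b d ha hb hd f hf]

lemma integral_eq (a b : ℝ) (ha : 0 < a) (hb : 0 < b) (f : ℝ → ℝ) :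
    ∫ x, f x ∂(betaMeasure a b) = (1 / betaFn a b) * ∫ t in Set.Ioo (0 : ℝ) 1,
        f t * t ^ (a - 1) * (1 - t) ^ (b - 1) := by
  rw [betaMeasure, integral_withDensity_eq_integral_toReal_smul (meas a b)
    (Filter.Eventually.of_forall fun x => ENNReal.ofReal_lt_top), ← integral_const_mul,
    ← integral_indicator measurableSet_Ioo]
  congr 1
  ext x
  rw [betaPDF, ENNReal.toReal_ofReal (nonneg ha hb x), smul_eq_mul]
  by_cases h : 0 < x ∧ x < 1
  · rw [betaPDFReal, if_pos h, Set.indicator_of_mem (by exact h)]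
    simp only [betaFn, beta]; ring
  · rw [betaPDFReal, if_neg h, Set.indicator_of_notMem (by exact h), zero_mul]

lemma ae_mem (a b : ℝ) : ∀ᵐ x ∂(betaMeasure a b), x ∈ Set.Icc (0 : ℝ) 1 := by
  rw [betaMeasure, ae_withDensity_iff (meas a b)]
  refine Filter.Eventually.of_forall fun x hx => ?_
  by_contra h
  apply hx
  by_cases h0 : 0 < x
  · exact betaPDF_eq_zero_of_one_le (le_of_lt (by
      by_contra h1; exact h ⟨h0.le, not_lt.1 h1⟩))
  · exact betaPDF_eq_zero_of_nonpos (not_lt.1 h0)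

lemma mean (a b : ℝ) (ha : 0 < a) (hb : 0 < b) : ∫ x, x ∂(betaMeasure a b) = a / (a + b) := by
  have h1 := integral_eq (a + 1) b (by positivity) hb (fun _ => 1)
  have := isProbabilityMeasureBeta (add_pos ha one_pos) hb
  rw [integral_eq a b ha hb]
  simp only [integral_const, probReal_univ, smul_eq_mul, mul_one] at h1
  have h2 : ∫ t in Set.Ioo (0 : ℝ) 1, t * t ^ (a - 1) * (1 - t) ^ (b - 1)
      = ∫ t in Set.Ioo (0 : ℝ) 1, 1 * t ^ (a + 1 - 1) * (1 - t) ^ (b - 1) := by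
    refine setIntegral_congr_fun measurableSet_Ioo fun t ht => ?_
    have : t ^ (a + 1 - 1) = t * t ^ (a - 1) := by
      rw [mul_comm, ← Real.rpow_add_one ht.1.ne']; congr 1; ring
    simp only [this, one_mul]
  have g1 := (Real.Gamma_pos_of_pos ha).ne'
  have g2 := (Real.Gamma_pos_of_pos hb).ne'
  have g3 := (Real.Gamma_pos_of_pos (add_pos ha hb)).ne'
  have hab := (add_pos ha hb).ne'
  rw [h2]
  simp only [betaFn] at h1 ⊢
  rw [show a + 1 + b = (a + b) + 1 by ring, Real.Gamma_add_one ha.ne', Real.Gamma_add_one hab] at h1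
  generalize (∫ t in Set.Ioo (0 : ℝ) 1, 1 * t ^ (a + 1 - 1) * (1 - t) ^ (b - 1)) = I at *
  field_simp at h1 ⊢
  linarith

end ScaledBeta

open ScaledBeta in
theorem scaled_beta_convex_order (a b c : ℝ) (ha : 0 < a) (hb : 0 < b) (hc : b ≤ c)
    (φ : ℝ → ℝ) (hφ : ConvexOn ℝ Set.univ φ) :
    (1 / betaFn a b) * ∫ t in Set.Ioo (0 : ℝ) 1,
        φ ((a + b) * t) * t ^ (a - 1) * (1 - t) ^ (b - 1) ≤
    (1 / betaFn a c) * ∫ t in Set.Ioo (0 : ℝ) 1,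
        φ ((a + c) * t) * t ^ (a - 1) * (1 - t) ^ (c - 1) := by
  rcases hc.eq_or_lt with rfl | hlt
  · exact le_rfl
  obtain ⟨d, hd, rfl⟩ : ∃ d, 0 < d ∧ c = b + d := ⟨c - b, by linarith, by ring⟩
  have hcont : Continuous φ := by
    rw [← continuousOn_univ]; exact hφ.continuousOn isOpen_univ
  have hab : 0 < a + b := by positivity
  have := isProbabilityMeasureBeta ha hb
  have := isProbabilityMeasureBeta hab hd
  obtain ⟨C, hC⟩ := (isCompact_Icc (a := (0 : ℝ)) (b := a + (b + d))).exists_bound_of_continuousOn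
    hcont.continuousOn
  have hC' : ∀ s : ℝ, 0 ≤ s → s ≤ 1 → ‖φ ((a + (b + d)) * s)‖ ≤ C := fun s h0 h1 =>
    hC _ ⟨by positivity, mul_le_of_le_one_right (by positivity) h1⟩
  rw [← integral_eq a b ha hb (fun t => φ ((a + b) * t)),
    ← integral_eq a (b + d) ha (by positivity) (fun t => φ ((a + (b + d)) * t)),
    ← map_eq a b d ha hb hd, integral_map (by fun_prop) (by fun_prop)]
  have hint : Integrable (fun p : ℝ × ℝ => φ ((a + (b + d)) * (p.2 * p.1)))
      ((betaMeasure a b).prod (betaMeasure (a + b) d)) := by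
    refine Integrable.of_bound (by fun_prop) C ?_
    have A1 := (Measure.quasiMeasurePreserving_fst (μ := betaMeasure a b)
      (ν := betaMeasure (a + b) d)).ae (ae_mem a b)
    have A2 := (Measure.quasiMeasurePreserving_snd (μ := betaMeasure a b)
      (ν := betaMeasure (a + b) d)).ae (ae_mem (a + b) d)
    filter_upwards [A1, A2] with p h1 h2
    exact hC' _ (mul_nonneg h2.1 h1.1) (mul_le_one₀ h2.2 h1.1 h1.2)
  rw [integral_prod _ hint]
  refine integral_mono_ae ?_ hint.integral_prod_left ?_
  · refine Integrable.of_bound (by fun_prop) C ?_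
    filter_upwards [ae_mem a b] with x hx
    exact hC _ ⟨mul_nonneg hab.le hx.1, by nlinarith [hx.1, hx.2]⟩
  · filter_upwards [ae_mem a b] with x hx
    have hid : Integrable (fun y : ℝ => y) (betaMeasure (a + b) d) := by
      refine Integrable.of_bound (by fun_prop) 1 ?_
      filter_upwards [ae_mem (a + b) d] with y hy
      rw [Real.norm_eq_abs, abs_of_nonneg hy.1]; exact hy.2
    have J := hφ.map_integral_le (μ := betaMeasure (a + b) d)
      (f := fun y => (a + (b + d)) * (y * x)) hcont.continuousOn isClosed_univ (by simp)
      ((hid.mul_const x).const_mul _) (by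
        refine Integrable.of_bound (by fun_prop) C ?_
        filter_upwards [ae_mem (a + b) d] with y hy
        exact hC' _ (mul_nonneg hy.1 hx.1) (mul_le_one₀ hy.2 hx.1 hx.2))
    rw [integral_const_mul, integral_mul_const, mean _ _ hab hd] at J
    have e : (a + (b + d)) * ((a + b) / (a + b + d) * x) = (a + b) * x := by
      have : a + b + d ≠ 0 := by positivity
      field_simp
      ring
    rwa [e] at J
end
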